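/- arXiv:2308.15082 — 4 statements merged into one kernel-verified Lean document; each statement's English description precedes it below -/
import Mathlib

section
/- Let n, m be positive integers, A an n×n complex matrix and B an n×m complex matrix. Then the pair [A,B] is exponentially stabilizable — i.e. there exist an m×n complex matrix K and constants M > 0, α > 0 such that ‖exp(t(A+BK))‖ ≤ M·e^{−αt} for all t ≥ 0 — if and only if for every λ ∈ ℂ with Re λ ≥ 0 and every v ∈ ℂⁿ, the conditions Aᴴ v = λ v and Bᴴ v = 0 imply v = 0. -/
open Matrix

open Polynomial in
/-- A rank-one update along a left eigenvector moves one root of the characteristic polynomial. -/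
theorem charpoly_add_vecMulVec_of_vecMul_eq_smul {R ι : Type*} [CommRing R] [IsDomain R]
    [Fintype ι] [DecidableEq ι] [Nonempty ι] {A : Matrix ι ι R} {w : ι → R} {μ : R}
    (h : w ᵥ* A = μ • w) (c : ι → R) :
    (X - C μ) * (A + vecMulVec c w).charpoly = (X - C (μ + c ⬝ᵥ w)) * A.charpoly := by
  set W : Matrix ι ι R[X] := C.mapMatrix (vecMulVec c w) with hW
  have hWA : W * C.mapMatrix A = C μ • W := by
    rw [hW, ← map_mul, vecMulVec_mul, h]
    ext i j : 2
    simp [vecMulVec_apply]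
  have hfac : (X - C μ) • charmatrix (A + vecMulVec c w) =
      (scalar ι (X - C μ) - W) * charmatrix A := by
    simp only [charmatrix, map_add, ← hW, sub_mul, mul_sub, hWA, scalar_apply,
      ← smul_one_eq_diagonal, smul_mul_assoc, mul_smul_comm, one_mul, mul_one, smul_sub, smul_add,
      sub_smul, smul_comm (C μ) X]
    abel
  have hrank : (scalar ι (X - C μ) - W).det =
      (X - C μ) ^ (Fintype.card ι - 1) * (X - C (μ + c ⬝ᵥ w)) := by
    have hW' : W = vecMulVec (C ∘ c) (C ∘ w) := by
      ext i j : 2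
      simp [hW, vecMulVec_apply]
    have hdot : (C ∘ c) ⬝ᵥ (C ∘ w) = C (c ⬝ᵥ w) := by
      simp [dotProduct]
    obtain ⟨k, hk⟩ := Nat.exists_eq_succ_of_ne_zero (Fintype.card_ne_zero (α := ι))
    rw [← eval_charpoly, hW', charpoly_vecMulVec, hdot, hk]
    simp [pow_succ]
    ring
  have hdet := congrArg det hfac
  rw [det_smul, det_mul, hrank] at hdet
  have hX : (X - C μ) ^ (Fintype.card ι - 1) ≠ 0 := pow_ne_zero _ (X_sub_C_ne_zero μ)
  apply mul_left_cancel₀ hX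
  rw [← mul_assoc, ← pow_succ, Nat.sub_add_cancel Fintype.card_pos, ← mul_assoc]
  exact hdet

/-- If every left eigenvector for an eigenvalue in `S` is seen by `B`, then some feedback moves
all eigenvalues out of `S`. -/
theorem exists_feedback_forall_isRoot_charpoly_notMem {𝕜 ι κ : Type*} [Field 𝕜]
    [Fintype ι] [DecidableEq ι] [Nonempty ι] [Fintype κ] [DecidableEq κ]
    (S : Set 𝕜) (hS : Sᶜ.Nonempty) (A : Matrix ι ι 𝕜) (B : Matrix ι κ 𝕜)
    (h : ∀ μ ∈ S, ∀ w : ι → 𝕜, w ᵥ* A = μ • w → w ᵥ* B = 0 → w = 0) :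
    ∃ K : Matrix κ ι 𝕜, ∀ μ, (A + B * K).charpoly.IsRoot μ → μ ∉ S := by
  classical
  obtain ⟨ν, hν⟩ := hS
  induction hN : (A.charpoly.roots.filter (· ∈ S)).card using Nat.strong_induction_on
    generalizing A with
  | _ N ih =>
  by_cases hroot : ∀ μ, A.charpoly.IsRoot μ → μ ∉ S
  · exact ⟨0, by simpa using hroot⟩
  push Not at hroot
  obtain ⟨μ, hμ, hμS⟩ := hroot
  obtain ⟨w, hw0, hw⟩ : ∃ w : ι → 𝕜, w ≠ 0 ∧ w ᵥ* A = μ • w := by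
    rw [Polynomial.IsRoot, eval_charpoly] at hμ
    obtain ⟨w, hw0, hw⟩ := exists_vecMul_eq_zero_iff.mpr hμ
    refine ⟨w, hw0, ?_⟩
    rw [vecMul_sub, sub_eq_zero, scalar_apply, ← smul_one_eq_diagonal, vecMul_smul,
      vecMul_one] at hw
    exact hw.symm
  obtain ⟨j, hj⟩ : ∃ j, (w ᵥ* B) j ≠ 0 := by
    by_contra! hB
    exact hw0 (h μ hμS w hw (funext hB))
  set u : κ → 𝕜 := Pi.single j ((ν - μ) / (w ᵥ* B) j) with hu
  have hdot : (B *ᵥ u) ⬝ᵥ w = ν - μ := by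
    rw [dotProduct_comm, dotProduct_mulVec, hu, dotProduct_single, mul_div_cancel₀ _ hj]
  have hfeed : ∀ L : Matrix κ ι 𝕜, A + B * (vecMulVec u w + L) =
      A + vecMulVec (B *ᵥ u) w + B * L := by
    intro L
    rw [Matrix.mul_add, mul_vecMulVec, add_assoc]
  have hchar := charpoly_add_vecMulVec_of_vecMul_eq_smul hw (B *ᵥ u)
  rw [hdot, add_sub_cancel] at hchar
  have hroots := congrArg Polynomial.roots hchar
  rw [Polynomial.roots_mul (mul_ne_zero (Polynomial.X_sub_C_ne_zero _) (charpoly_monic _).ne_zero),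
    Polynomial.roots_mul (mul_ne_zero (Polynomial.X_sub_C_ne_zero _) (charpoly_monic _).ne_zero),
    Polynomial.roots_X_sub_C, Polynomial.roots_X_sub_C] at hroots
  have hcard := congrArg (fun s => (s.filter (· ∈ S)).card) hroots
  have hν' : ν ∉ S := hν
  simp only [Multiset.filter_add, Multiset.filter_singleton, hμS, hν', if_true, if_false,
    Multiset.card_add, Multiset.card_singleton, Multiset.empty_eq_zero, Multiset.card_zero] at hcard
  obtain ⟨L, hL⟩ := ih _ (by omega) (A + vecMulVec (B *ᵥ u) w) (by
    intro lam hlam z hz hzB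
    refine h lam hlam z ?_ hzB
    rwa [vecMul_add, vecMul_vecMulVec, dotProduct_mulVec, hzB, zero_dotProduct,
      zero_smul, add_zero] at hz) rfl
  exact ⟨vecMulVec u w + L, by rwa [hfeed]⟩

/-- An eigenvector of `T` is an eigenvector of `exp T`. -/
theorem ContinuousLinearMap.exp_apply_of_apply_eq_smul {E : Type*} [NormedAddCommGroup E]
    [NormedSpace ℂ E] [CompleteSpace E] {T : E →L[ℂ] E} {v : E} {μ : ℂ} (h : T v = μ • v) :
    NormedSpace.exp T v = Complex.exp μ • v := by
  have hpow : ∀ k : ℕ, (T ^ k) v = μ ^ k • v := by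
    intro k
    induction k with
    | zero => simp
    | succ k ih => rw [pow_succ, mul_apply_eq_comp, h, map_smul, ih, smul_smul, pow_succ']
  have h₁ := (NormedSpace.exp_series_hasSum_exp' (𝕂 := ℂ) T).mapL (ContinuousLinearMap.apply ℂ E v)
  have h₂ := (NormedSpace.exp_series_hasSum_exp' (𝕂 := ℂ) μ).smul_const v
  rw [← Complex.exp_eq_exp_ℂ] at h₂
  refine h₁.unique (h₂.congr_fun ?_)
  intro k
  simp [hpow, smul_smul]

/-- Spectral inclusion for the exponential in finite dimension. -/
theorem ContinuousLinearMap.exists_mem_spectrum_of_mem_spectrum_exp {E : Type*}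
    [NormedAddCommGroup E] [NormedSpace ℂ E] [FiniteDimensional ℂ E] {T : E →L[ℂ] E} {z : ℂ}
    (hz : z ∈ spectrum ℂ (NormedSpace.exp T)) : ∃ μ ∈ spectrum ℂ T, Complex.exp μ = z := by
  have : CompleteSpace E := FiniteDimensional.complete ℂ E
  have hspec : ∀ U : E →L[ℂ] E, spectrum ℂ (U : E →ₗ[ℂ] E) = spectrum ℂ U := fun U =>
    AlgEquiv.spectrum_eq (Module.End.toContinuousLinearMap E).symm U
  rw [← hspec, ← Module.End.hasEigenvalue_iff_mem_spectrum] at hz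
  set V := Module.End.eigenspace (NormedSpace.exp T : E →L[ℂ] E).toLinearMap z with hV
  have hmaps : ∀ x ∈ V, T x ∈ V := by
    intro x hx
    rw [hV, Module.End.mem_eigenspace_iff] at hx ⊢
    have hcomm : Commute (NormedSpace.exp T) T := (Commute.refl T).exp_left
    have := congrArg (fun U : E →L[ℂ] E => U x) hcomm.eq
    simp only [mul_apply_eq_comp] at this
    simp only [coe_coe] at hx ⊢
    rw [this, hx, map_smul]
  have : Nontrivial V := Submodule.nontrivial_iff_ne_bot.mpr hz
  obtain ⟨μ, hμ⟩ := Module.End.exists_eigenvalue ((T : E →ₗ[ℂ] E).restrict hmaps)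
  obtain ⟨x, hx, hx0⟩ := hμ.exists_hasEigenvector
  have hTx : T x = μ • (x : E) := by
    simpa using congrArg Subtype.val (Module.End.mem_eigenspace_iff.mp hx)
  have hx0' : (x : E) ≠ 0 := by simpa using hx0
  refine ⟨μ, ?_, ?_⟩
  · rw [← hspec, ← Module.End.hasEigenvalue_iff_mem_spectrum]
    exact Module.End.hasEigenvalue_of_hasEigenvector
      ⟨Module.End.mem_eigenspace_iff.mpr hTx, hx0'⟩
  · have h₁ : NormedSpace.exp T (x : E) = z • (x : E) := Module.End.mem_eigenspace_iff.mp x.2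
    rw [exp_apply_of_apply_eq_smul hTx] at h₁
    exact smul_left_injective ℂ hx0' h₁

/-- An element of a Banach algebra with spectral radius less than one is power bounded. -/
theorem exists_forall_norm_pow_le_of_spectralRadius_lt_one {𝔸 : Type*} [NormedRing 𝔸]
    [NormedAlgebra ℂ 𝔸] [CompleteSpace 𝔸] {a : 𝔸} (ha : spectralRadius ℂ a < 1) :
    ∃ C : ℝ, ∀ k : ℕ, ‖a ^ k‖ ≤ C := by
  have hev := (spectrum.pow_nnnorm_pow_one_div_tendsto_nhds_spectralRadius a).eventually_lt_const ha
  have hbdd : Filter.IsBoundedUnder (· ≤ ·) Filter.atTop (fun k : ℕ => ‖a ^ k‖) := by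
    refine ⟨1, ?_⟩
    rw [Filter.eventually_map]
    filter_upwards [hev, Filter.eventually_gt_atTop 0] with k hk hk0
    have h1 : ((‖a ^ k‖₊ : ENNReal)) < 1 := by
      by_contra! hge
      exact absurd hk (not_lt.mpr (ENNReal.one_le_rpow hge (by positivity)))
    have h2 : ‖a ^ k‖₊ < 1 := by exact_mod_cast h1
    exact_mod_cast h2.le
  obtain ⟨C, hC⟩ := hbdd.bddAbove_range
  exact ⟨C, fun k => hC ⟨k, rfl⟩⟩

/-- A semigroup `exp (t T)` whose generator has spectrum in the open left half plane is bounded. -/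
theorem ContinuousLinearMap.exists_forall_norm_exp_smul_le {E : Type*} [NormedAddCommGroup E]
    [NormedSpace ℂ E] [FiniteDimensional ℂ E] [Nontrivial E] {T : E →L[ℂ] E}
    (hT : ∀ μ ∈ spectrum ℂ T, μ.re < 0) :
    ∃ C : ℝ, ∀ t : ℝ, 0 ≤ t → ‖NormedSpace.exp (t • T)‖ ≤ C := by
  have : CompleteSpace E := FiniteDimensional.complete ℂ E
  have hrad : spectralRadius ℂ (NormedSpace.exp T) < 1 := by
    refine spectrum.spectralRadius_lt_of_forall_lt (r := 1) _ fun z hz => ?_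
    obtain ⟨μ, hμ, rfl⟩ := exists_mem_spectrum_of_mem_spectrum_exp hz
    rw [← NNReal.coe_lt_coe, coe_nnnorm, Complex.norm_exp, NNReal.coe_one, Real.exp_lt_one_iff]
    exact hT μ hμ
  let _ : NormedAlgebra ℚ (E →L[ℂ] E) := NormedAlgebra.restrictScalars ℚ ℂ _
  obtain ⟨C₁, hC₁⟩ := exists_forall_norm_pow_le_of_spectralRadius_lt_one hrad
  have hcont : Continuous fun s : ℝ => NormedSpace.exp (s • T) :=
    (NormedSpace.exp_continuous).comp (continuous_id.smul continuous_const)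
  obtain ⟨C₂, hC₂⟩ := (isCompact_Icc (a := (0 : ℝ)) (b := 1)).exists_bound_of_continuousOn
    hcont.continuousOn
  refine ⟨C₁ * C₂, fun t ht => ?_⟩
  have hsplit : t • T = ⌊t⌋₊ • T + (t - ⌊t⌋₊) • T := by
    rw [← Nat.cast_smul_eq_nsmul ℝ, ← add_smul, add_sub_cancel]
  have hcomm : Commute (⌊t⌋₊ • T) ((t - ⌊t⌋₊) • T) :=
    ((Commute.refl T).smul_left _).smul_right _
  rw [hsplit, NormedSpace.exp_add_of_commute hcomm, NormedSpace.exp_nsmul]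
  have hC₁0 : 0 ≤ C₁ := (norm_nonneg _).trans (hC₁ 0)
  refine (norm_mul_le _ _).trans (mul_le_mul (hC₁ _) (hC₂ _ ⟨?_, ?_⟩) (norm_nonneg _) hC₁0)
  · linarith [Nat.floor_le ht]
  · linarith [Nat.lt_floor_add_one t]

/-- A semigroup `exp (t T)` whose generator has spectrum in the open left half plane is
exponentially stable. -/
theorem ContinuousLinearMap.exists_forall_norm_exp_smul_le_mul_exp {E : Type*}
    [NormedAddCommGroup E] [NormedSpace ℂ E] [FiniteDimensional ℂ E] [Nontrivial E]
    {T : E →L[ℂ] E} (hT : ∀ μ ∈ spectrum ℂ T, μ.re < 0) :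
    ∃ M : ℝ, 0 < M ∧ ∃ α : ℝ, 0 < α ∧
      ∀ t : ℝ, 0 ≤ t → ‖NormedSpace.exp (t • T)‖ ≤ M * Real.exp (-α * t) := by
  have : CompleteSpace E := FiniteDimensional.complete ℂ E
  let _ : NormedAlgebra ℚ (E →L[ℂ] E) := NormedAlgebra.restrictScalars ℚ ℂ _
  obtain ⟨μ₀, hμ₀, hmax⟩ := (spectrum.isCompact (𝕜 := ℂ) T).exists_isMaxOn (spectrum.nonempty T)
    Complex.continuous_re.continuousOn
  set α : ℝ := -μ₀.re / 2 with hα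
  have hα0 : 0 < α := by linarith [hT μ₀ hμ₀]
  obtain ⟨C, hC⟩ := exists_forall_norm_exp_smul_le (T := T + algebraMap ℂ _ (α : ℂ)) (by
    intro μ hμ
    rw [add_comm, ← sub_add_cancel μ (α : ℂ), spectrum.add_mem_add_iff] at hμ
    have := hmax hμ
    simp at this
    linarith [hT μ₀ hμ₀])
  refine ⟨max C 1, by positivity, α, hα0, fun t ht => ?_⟩
  have hsplit : t • T = t • (T + algebraMap ℂ _ (α : ℂ)) + algebraMap ℂ _ ((-α * t : ℝ) : ℂ) := by
    ext x
    simp [Algebra.algebraMap_eq_smul_one, ← Complex.coe_smul, smul_smul]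
    module
  rw [hsplit, NormedSpace.exp_add_of_commute (Algebra.commutes _ _).symm,
    ← NormedSpace.algebraMap_exp_comm, ← Complex.exp_eq_exp_ℂ]
  refine (norm_mul_le _ _).trans (mul_le_mul ((hC t ht).trans (le_max_left _ _)) ?_
    (norm_nonneg _) (by positivity))
  rw [norm_algebraMap', ← Complex.ofReal_exp, Complex.norm_real,
    Real.norm_of_nonneg (Real.exp_nonneg _)]

/-- An eigenvalue of the adjoint of an exponentially stable generator has negative real part. -/
theorem ContinuousLinearMap.eq_zero_of_adjoint_apply_eq_smul {E : Type*} [NormedAddCommGroup E]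
    [InnerProductSpace ℂ E] [CompleteSpace E] {T : E →L[ℂ] E} {M α : ℝ} (hα : 0 < α)
    (hT : ∀ t : ℝ, 0 ≤ t → ‖NormedSpace.exp (t • T)‖ ≤ M * Real.exp (-α * t))
    {μ : ℂ} (hμ : 0 ≤ μ.re) {v : E} (hv : star T v = μ • v) : v = 0 := by
  by_contra hv0
  have hbound : ∀ t : ℝ, 0 ≤ t → 1 ≤ M * Real.exp (-α * t) := by
    intro t ht
    have hexp : NormedSpace.exp (t • star T) v = Complex.exp (t * μ) • v := by
      apply exp_apply_of_apply_eq_smul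
      rw [_root_.smul_apply, hv, mul_smul, Complex.coe_smul]
    have hstar : NormedSpace.exp (t • star T) = star (NormedSpace.exp (t • T)) := by
      rw [NormedSpace.star_exp, star_smul, star_trivial t]
    have hle := (NormedSpace.exp (t • star T)).le_opNorm v
    rw [hexp, norm_smul, hstar, norm_star, Complex.norm_exp] at hle
    have hle' := le_of_mul_le_mul_right hle (norm_pos_iff.mpr hv0)
    refine le_trans ?_ (hle'.trans (hT t ht))
    rw [Real.one_le_exp_iff, Complex.re_ofReal_mul]
    positivity
  have hlim : Filter.Tendsto (fun t : ℝ => M * Real.exp (-α * t)) Filter.atTop (nhds 0) := by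
    have h₁ : Filter.Tendsto (fun t : ℝ => -α * t) Filter.atTop Filter.atBot :=
      Filter.tendsto_id.const_mul_atTop_of_neg (by linarith)
    simpa using (Real.tendsto_exp_atBot.comp h₁).const_mul M
  have := ge_of_tendsto hlim ((Filter.eventually_ge_atTop 0).mono hbound)
  linarith

/-- Hautus test for exponential stabilizability of finite-dimensional systems:
the pair `[A,B]` is exponentially stabilizable iff
`Ker (λI - Aᴴ, Bᴴ)ᵀ = {0}` for every `λ` with `Re λ ≥ 0`. -/
theorem matrix_stabilizable_iff_hautus
    {n m : ℕ} (hn : 0 < n) (hm : 0 < m)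
    (A : Matrix (Fin n) (Fin n) ℂ) (B : Matrix (Fin n) (Fin m) ℂ) :
    (∃ K : Matrix (Fin m) (Fin n) ℂ, ∃ M : ℝ, 0 < M ∧ ∃ α : ℝ, 0 < α ∧
      ∀ t : ℝ, 0 ≤ t →
        ‖NormedSpace.exp (t • Matrix.toEuclideanCLM (𝕜 := ℂ) (A + B * K))‖
          ≤ M * Real.exp (-α * t)) ↔
    (∀ (lam : ℂ) (v : Fin n → ℂ), 0 ≤ lam.re →
      Matrix.mulVec Aᴴ v = lam • v → Matrix.mulVec Bᴴ v = 0 → v = 0) := by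
  have : Nonempty (Fin n) := ⟨⟨0, hn⟩⟩
  constructor
  · rintro ⟨K, M, -, α, hα, hK⟩ lam v hlam hA hB
    have hv : star (toEuclideanCLM (𝕜 := ℂ) (A + B * K)) (WithLp.toLp 2 v) =
        lam • WithLp.toLp 2 v := by
      rw [← map_star, star_eq_conjTranspose, toEuclideanCLM_toLp, conjTranspose_add,
        conjTranspose_mul, add_mulVec, ← mulVec_mulVec, hA, hB, mulVec_zero, add_zero]
      rfl
    simpa using ContinuousLinearMap.eq_zero_of_adjoint_apply_eq_smul hα hK hlam hv
  · intro h
    obtain ⟨K, hK⟩ := exists_feedback_forall_isRoot_charpoly_notMem {μ : ℂ | 0 ≤ μ.re}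
      ⟨-1, by simp⟩ A B (by
        intro μ hμ w hwA hwB
        have h0 := h (star μ) (star w) (by simpa using hμ)
          (by rw [← star_vecMul, hwA, star_smul]) (by rw [← star_vecMul, hwB, star_zero])
        simpa using h0)
    refine ⟨K, ContinuousLinearMap.exists_forall_norm_exp_smul_le_mul_exp fun μ hμ => ?_⟩
    rw [AlgEquiv.spectrum_eq, mem_spectrum_iff_isRoot_charpoly] at hμ
    simpa using hK μ hμ
end

section
/- Let H and U be separable complex Hilbert spaces, A : H → H and B : U → H bounded linear operators. The following statements are equivalent: (i) there exists T > 0 such that the system is exactly controllable at time T, i.e. for all y₀, y₁ ∈ H there exists u ∈ L²((0,T);U) with y₁ = exp(TA)y₀ + ∫₀ᵀ exp((T−s)A)(B u(s)) ds; (ii) there exist T > 0 and C > 0 such that ‖φ‖² ≤ C·∫₀ᵀ ‖B*(exp(tA*)φ)‖² dt for all φ ∈ H; (iii) there exists n ∈ ℕ such that the (algebraic) linear span of the set {Aᵏ(B u) : 0 ≤ k ≤ n, u ∈ U} equals H; (iv) for every λ ∈ ℂ there exists C(λ) > 0 such that ‖φ‖² ≤ C(λ)·(‖λφ − A*φ‖²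 + ‖B*φ‖²) for all φ ∈ H. -/
open MeasureTheory

theorem Submodule.exists_dual_eq_zero_of_notMem_closure {E : Type*} [NormedAddCommGroup E]
    [NormedSpace ℂ E] (p : Submodule ℂ E) {x : E} (hx : x ∉ closure (p : Set E)) :
    ∃ f : StrongDual ℂ E, (∀ z ∈ p, f z = 0) ∧ f x ≠ 0 := by
  let q := p.topologicalClosure
  have hq : IsClosed (q : Set E) := p.isClosed_topologicalClosure
  have hxq : x ∉ q := hx
  have hne : q.mkQ x ≠ 0 := by simpa using hxq
  obtain ⟨g, -, hg⟩ := exists_dual_vector ℂ (q.mkQ x) (norm_ne_zero_iff.mpr hne)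
  refine ⟨g.comp q.mkQL, fun z hz => ?_, ?_⟩
  · have : q.mkQ z = 0 := by simpa using p.le_topologicalClosure hz
    change g (q.mkQ z) = 0
    rw [this, map_zero]
  · change g (q.mkQ x) ≠ 0
    rw [hg]
    simpa using hne

/-- The approximate point spectrum of a bounded operator on a nonzero Banach space is nonempty. -/
theorem ContinuousLinearMap.exists_norm_smul_sub_lt {E : Type*} [NormedAddCommGroup E]
    [NormedSpace ℂ E] [CompleteSpace E] [Nontrivial E] (T : E →L[ℂ] E) :
    ∃ μ : ℂ, ∀ c : ℝ, 0 < c → ∃ x : E, ‖μ • x - T x‖ < c * ‖x‖ := by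
  by_contra! h
  have hclosed : IsClosed (resolventSet ℂ T) := by
    rw [← closure_subset_iff_isClosed]
    intro μ hμ
    obtain ⟨c, hc, hb⟩ := h μ
    obtain ⟨ν, ⟨u, hu⟩, hν⟩ := Metric.mem_closure_iff.mp hμ (c / 2) (half_pos hc)
    rw [dist_eq_norm] at hν
    have hu' : ∀ x, (u : E →L[ℂ] E) x = ν • x - T x := fun x => by
      rw [hu]; simp [Algebra.algebraMap_eq_smul_one]
    have hinv : ‖(↑u⁻¹ : E →L[ℂ] E)‖ ≤ 2 / c := by
      refine ContinuousLinearMap.opNorm_le_bound _ (by positivity) fun y => ?_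
      set x := (↑u⁻¹ : E →L[ℂ] E) y with hx
      have hy : y = ν • x - T x := by
        rw [← hu', hx, ← mul_apply_eq_comp, Units.mul_inv,
          one_apply_eq_self]
      have h1 : μ • x - T x = y + (μ - ν) • x := by rw [hy, sub_smul]; abel
      have h2 := hb x
      rw [h1] at h2
      have h3 := norm_add_le y ((μ - ν) • x)
      rw [norm_smul] at h3
      have h4 : ‖μ - ν‖ * ‖x‖ ≤ c / 2 * ‖x‖ := by gcongr
      rw [div_mul_eq_mul_div, le_div_iff₀ hc]
      linarith
    have hpos : 0 < ‖(↑u⁻¹ : E →L[ℂ] E)‖ := norm_pos_iff.mpr (Units.ne_zero _)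
    refine (u.ofNearby (algebraMap ℂ _ μ - T) ?_).isUnit
    have h5 : algebraMap ℂ (E →L[ℂ] E) μ - T - u = algebraMap ℂ _ (μ - ν) := by
      rw [hu, map_sub]; abel
    rw [h5, norm_algebraMap']
    refine hν.trans_le ?_
    rw [le_inv_comm₀ (half_pos hc) hpos]
    simpa using hinv
  rcases isClopen_iff.mp ⟨hclosed, spectrum.isOpen_resolventSet T⟩ with h0 | h1
  · have := spectrum.mem_resolventSet_of_norm_lt_mul (𝕜 := ℂ) (a := T)
      (k := ((‖T‖ * ‖(1 : E →L[ℂ] E)‖ + 1 : ℝ) : ℂ)) (by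
        rw [Complex.norm_real, Real.norm_of_nonneg (by positivity)]; linarith)
    rw [h0] at this
    exact this
  · obtain ⟨k, hk⟩ := spectrum.nonempty T
    exact hk (h1 ▸ Set.mem_univ k)

theorem Continuous.integrable_clm_apply {E F : Type*} [NormedAddCommGroup E] [NormedSpace ℂ E]
    [NormedAddCommGroup F] [NormedSpace ℂ F] {K : ℝ → E →L[ℂ] F} (hK : Continuous K) {u : ℝ → E}
    {T : ℝ} (hu : Integrable u (volume.restrict (Set.Ioc 0 T))) :
    Integrable (fun s => K s (u s)) (volume.restrict (Set.Ioc 0 T)) := by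
  obtain ⟨C, hC⟩ := (isCompact_Icc (a := 0) (b := T)).exists_bound_of_continuousOn hK.continuousOn
  refine (hu.norm.const_mul C).mono' ?_ ?_
  · exact (ContinuousLinearMap.apply ℂ F : E →L[ℂ] _).aestronglyMeasurable_comp₂
      hu.aestronglyMeasurable hK.aestronglyMeasurable
  · filter_upwards [ae_restrict_mem measurableSet_Ioc] with s hs
    exact (K s).le_of_opNorm_le (hC s ⟨hs.1.le, hs.2⟩) _

section Hilbert

variable {H U : Type*}
    [NormedAddCommGroup H] [InnerProductSpace ℂ H]
    [NormedAddCommGroup U] [InnerProductSpace ℂ U]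

/-- The span of the vectors `A ^ k (B u)` with `k ≤ n`. -/
def kalmanSpan (A : H →L[ℂ] H) (B : U →L[ℂ] H) (n : ℕ) : Submodule ℂ H :=
  Submodule.span ℂ {x : H | ∃ k : ℕ, k ≤ n ∧ ∃ u : U, x = (A ^ k) (B u)}

theorem kalmanSpan_mono (A : H →L[ℂ] H) (B : U →L[ℂ] H) : Monotone (kalmanSpan A B) :=
  fun _ _ h => Submodule.span_mono fun _ ⟨k, hk, u, hx⟩ => ⟨k, hk.trans h, u, hx⟩

theorem apply_mem_kalmanSpan {A : H →L[ℂ] H} {B : U →L[ℂ] H} {n : ℕ} {x : H}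
    (hx : x ∈ kalmanSpan A B n) : A x ∈ kalmanSpan A B (n + 1) := by
  have : kalmanSpan A B n ≤ (kalmanSpan A B (n + 1)).comap A.toLinearMap := by
    refine Submodule.span_le.mpr ?_
    rintro _ ⟨k, hk, u, rfl⟩
    exact Submodule.subset_span ⟨k + 1, by omega, u, by rw [pow_succ']; rfl⟩
  exact this hx

/-- The right ideal of operators with range in some `kalmanSpan A B n`. -/
def kalmanIdeal (A : H →L[ℂ] H) (B : U →L[ℂ] H) : Submodule ℂ (H →L[ℂ] H) where
  carrier := {Z | ∃ n, ∀ y, Z y ∈ kalmanSpan A B n}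
  zero_mem' := ⟨0, fun _ => Submodule.zero_mem _⟩
  add_mem' := by
    rintro Z W ⟨n, hn⟩ ⟨m, hm⟩
    exact ⟨max n m, fun y => Submodule.add_mem _ (kalmanSpan_mono A B (le_max_left _ _) (hn y))
      (kalmanSpan_mono A B (le_max_right _ _) (hm y))⟩
  smul_mem' := by
    rintro c Z ⟨n, hn⟩
    exact ⟨n, fun y => Submodule.smul_mem _ c (hn y)⟩

variable [CompleteSpace H]

open NormedSpace in
theorem continuous_exp_real_smul (A : H →L[ℂ] H) : Continuous fun t : ℝ => exp (t • A) :=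
  continuous_iff_continuousAt.mpr fun t => (hasDerivAt_exp_smul_const A t).continuousAt

theorem ContinuousLinearMap.adjoint_exp_real_smul (A : H →L[ℂ] H) (t : ℝ) :
    adjoint (NormedSpace.exp (t • A)) = NormedSpace.exp (t • adjoint A) := by
  rw [← star_eq_adjoint, NormedSpace.star_exp, star_smul, star_trivial]
  rfl

open NormedSpace in
theorem exists_exp_real_smul_eq (A : H →L[ℂ] H) (lam : ℂ) :
    ∃ (c : ℝ → ℂ) (G : ℝ → H →L[ℂ] H), Continuous c ∧ Continuous G ∧
      ∀ t : ℝ, exp (t • A) = c t • (1 : H →L[ℂ] H) + (lam • (1 : H →L[ℂ] H) - A) * G t := by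
  let F : ℝ → H →L[ℂ] H := fun t => Complex.exp (-lam * t) • exp (t • A)
  have hc : ∀ μ : ℂ, Continuous fun t : ℝ => Complex.exp (μ * t) := fun μ => by fun_prop
  have hF : Continuous F := (hc _).smul (continuous_exp_real_smul A)
  have hder : ∀ t, HasDerivAt F ((A - lam • (1 : H →L[ℂ] H)) * F t) t := by
    intro t
    have h1 : HasDerivAt (fun t : ℝ => Complex.exp (-lam * t))
        (Complex.exp (-lam * t) * -lam) t := by
      simpa using (((hasDerivAt_id (t : ℂ)).const_mul (-lam)).cexp).comp_ofReal
    convert! h1.smul (hasDerivAt_exp_smul_const' A t) using 1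
    simp only [F, sub_mul, mul_smul_comm, smul_mul_assoc, one_mul, mul_smul, neg_smul,
      smul_neg, smul_sub]
    rw [smul_comm (Complex.exp _) lam]
    abel
  refine ⟨fun t => Complex.exp (lam * t),
    fun t => -(Complex.exp (lam * t) • ∫ r in (0 : ℝ)..t, F r), hc _, ?_, fun t => ?_⟩
  · exact ((hc _).smul (intervalIntegral.continuous_primitive
      (fun _ _ => hF.intervalIntegrable _ _) 0)).neg
  · have h1 : ∫ r in (0 : ℝ)..t, (A - lam • (1 : H →L[ℂ] H)) * F r = F t - F 0 :=
      intervalIntegral.integral_eq_sub_of_hasDerivAt (fun x _ => hder x)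
        ((continuous_const.mul hF).intervalIntegrable _ _)
    have h2 : ∫ r in (0 : ℝ)..t, (A - lam • (1 : H →L[ℂ] H)) * F r
        = (A - lam • (1 : H →L[ℂ] H)) * ∫ r in (0 : ℝ)..t, F r :=
      (ContinuousLinearMap.mul ℂ (H →L[ℂ] H) (A - lam • (1 : H →L[ℂ] H))).intervalIntegral_comp_comm
        (hF.intervalIntegrable _ _)
    have h3 : exp (t • A) = Complex.exp (lam * t) • F t := by
      simp only [F]
      rw [smul_smul, ← Complex.exp_add]
      simp
    have h4 : F 0 = 1 := by simp [F]
    rw [h2, h4, eq_sub_iff_add_eq] at h1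
    rw [h3, ← h1, smul_add, mul_neg, mul_smul_comm, ← neg_sub A, neg_mul, smul_neg, neg_neg]
    abel

theorem ContinuousLinearMap.isUnit_of_le_re_inner {G : H →L[ℂ] H} {C : ℝ} (hC : 0 < C)
    (h : ∀ x, ‖x‖ ^ 2 ≤ C * (inner ℂ x (G x)).re) : IsUnit G := by
  refine ContinuousLinearMap.isUnit_of_forall_le_norm_inner_map G (c := ⟨C⁻¹, by positivity⟩)
    (by change (0 : ℝ) < C⁻¹; positivity) fun x => ?_
  have h1 := h x
  have h2 : (inner ℂ x (G x)).re ≤ ‖inner ℂ (G x) x‖ := by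
    rw [norm_inner_symm]; exact Complex.re_le_norm _
  change ‖x‖ ^ 2 * C⁻¹ ≤ _
  rw [mul_inv_le_iff₀ hC, mul_comm]
  exact h1.trans (by gcongr)

theorem kalmanSpan_eq_top_of_hautus {A : H →L[ℂ] H} {B : U →L[ℂ] H}
    (h : ∀ lam : ℂ, ∃ (X : H →L[ℂ] H) (Y : H →L[ℂ] U),
      (lam • (1 : H →L[ℂ] H) - A) ∘L X + B ∘L Y = 1) :
    ∃ n, kalmanSpan A B n = ⊤ := by
  let J := kalmanIdeal A B
  suffices h1 : (1 : H →L[ℂ] H) ∈ closure (J : Set (H →L[ℂ] H)) by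
    obtain ⟨_, ⟨u, rfl⟩, n, hn⟩ := mem_closure_iff.mp h1 _ Units.isOpen isUnit_one
    refine ⟨n, eq_top_iff.mpr fun y _ => ?_⟩
    have := hn ((↑u⁻¹ : H →L[ℂ] H) y)
    rwa [← mul_apply_eq_comp, Units.mul_inv, one_apply_eq_self] at this
  by_contra h1
  obtain ⟨f, hfJ, hf1⟩ := J.exists_dual_eq_zero_of_notMem_closure h1
  let L : (H →L[ℂ] H) →L[ℂ] (H →L[ℂ] H) := ContinuousLinearMap.mul ℂ (H →L[ℂ] H) A
  let N : Submodule ℂ (StrongDual ℂ (H →L[ℂ] H)) :=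
    { carrier := {g | ∀ Z ∈ J, g Z = 0}
      zero_mem' := fun _ _ => rfl
      add_mem' := fun ha hb Z hZ => by rw [add_apply, ha Z hZ, hb Z hZ, add_zero]
      smul_mem' := fun c g hg Z hZ => by
        change c • g Z = 0
        rw [hg Z hZ, smul_zero] }
  have hN : IsClosed (N : Set (StrongDual ℂ (H →L[ℂ] H))) := by
    have : (N : Set (StrongDual ℂ (H →L[ℂ] H))) = ⋂ Z ∈ J, {g | g Z = 0} := by
      ext g; simp [N]
    rw [this]
    exact isClosed_biInter fun Z _ => isClosed_eq (by fun_prop) continuous_const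
  have : CompleteSpace N := hN.completeSpace_coe
  have : Nontrivial N := ⟨⟨⟨f, hfJ⟩, 0, fun h0 => hf1 (by
    have := congrArg Subtype.val h0
    change f = 0 at this
    rw [this]; rfl)⟩⟩
  let T₀ : StrongDual ℂ (H →L[ℂ] H) →L[ℂ] StrongDual ℂ (H →L[ℂ] H) :=
    (ContinuousLinearMap.compL ℂ (H →L[ℂ] H) (H →L[ℂ] H) ℂ).flip L
  have hT₀ : ∀ g Z, T₀ g Z = g (A * Z) := fun g Z => rfl
  have hTN : ∀ g : N, (T₀ ∘L N.subtypeL) g ∈ N := by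
    rintro ⟨g, hg⟩ Z ⟨n, hn⟩
    exact hg _ ⟨n + 1, fun y => apply_mem_kalmanSpan (hn y)⟩
  let T : N →L[ℂ] N := (T₀ ∘L N.subtypeL).codRestrict N hTN
  obtain ⟨lam, hlam⟩ := ContinuousLinearMap.exists_norm_smul_sub_lt (E := N) T
  obtain ⟨X, Y, hXY⟩ := h lam
  obtain ⟨g, hg⟩ := hlam (‖X‖ + 1)⁻¹ (by positivity)
  refine hg.not_ge ?_
  rw [inv_mul_le_iff₀ (by positivity)]
  change ‖(g : StrongDual ℂ (H →L[ℂ] H))‖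
    ≤ (‖X‖ + 1) * ‖lam • (g : StrongDual ℂ (H →L[ℂ] H)) - T₀ g‖
  refine ContinuousLinearMap.opNorm_le_bound _ (by positivity) fun Z => ?_
  have h2 : (g : StrongDual ℂ (H →L[ℂ] H)) Z
      = (lam • (g : StrongDual ℂ (H →L[ℂ] H)) - T₀ g) (X * Z) := by
    have hZ : Z = lam • (X * Z) - A * (X * Z) + B ∘L Y ∘L Z := by
      conv_lhs => rw [← one_mul Z, ← hXY]
      ext y
      simp
    have hB : (g : StrongDual ℂ (H →L[ℂ] H)) (B ∘L Y ∘L Z) = 0 :=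
      g.2 _ ⟨0, fun y => Submodule.subset_span ⟨0, le_rfl, Y (Z y), by simp⟩⟩
    conv_lhs => rw [hZ]
    rw [map_add, hB, add_zero, map_sub, map_smul]
    rfl
  rw [h2]
  calc _ ≤ ‖lam • (g : StrongDual ℂ (H →L[ℂ] H)) - T₀ g‖ * (‖X‖ * ‖Z‖) :=
        (ContinuousLinearMap.le_opNorm _ _).trans (by gcongr; exact norm_mul_le _ _)
    _ ≤ ‖lam • (g : StrongDual ℂ (H →L[ℂ] H)) - T₀ g‖ * ((‖X‖ + 1) * ‖Z‖) := by gcongr; linarith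
    _ = _ := by ring

/-- The right ideal of operators `∫₀¹ exp (s A) B V(s) ds` with `V` continuous. -/
noncomputable def controlIdeal (A : H →L[ℂ] H) (B : U →L[ℂ] H) : Submodule ℂ (H →L[ℂ] H) where
  carrier := {Z | ∃ V : ℝ → H →L[ℂ] U, Continuous V ∧
    Z = ∫ s in Set.Ioc (0 : ℝ) 1, NormedSpace.exp (s • A) * (B ∘L V s)}
  zero_mem' := ⟨0, continuous_const, by simp⟩
  add_mem' := by
    rintro _ _ ⟨V, hV, rfl⟩ ⟨W, hW, rfl⟩
    have h := continuous_exp_real_smul A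
    refine ⟨V + W, hV.add hW, ?_⟩
    rw [← integral_add]
    · simp [mul_add]
    · exact Continuous.integrableOn_Ioc (by fun_prop)
    · exact Continuous.integrableOn_Ioc (by fun_prop)
  smul_mem' := by
    rintro c _ ⟨V, hV, rfl⟩
    refine ⟨c • V, hV.const_smul c, ?_⟩
    rw [← integral_smul]
    simp

theorem eq_zero_of_eq_zero_on_controlIdeal {A : H →L[ℂ] H} {B : U →L[ℂ] H}
    {f : StrongDual ℂ (H →L[ℂ] H)} (hf : ∀ Z ∈ controlIdeal A B, f Z = 0) (X : H →L[ℂ] U) (k : ℕ) :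
    ∀ t ∈ Set.Ioo (0 : ℝ) 1, f (NormedSpace.exp (t • A) * (A ^ k * (B ∘L X))) = 0 := by
  have hexp := continuous_exp_real_smul A
  induction k with
  | zero =>
    let g : ℝ → ℂ := fun t => f (NormedSpace.exp (t • A) * (B ∘L X))
    have hg : Continuous g := by fun_prop
    have h1 := hf _ ⟨fun s => (starRingEnd ℂ (g s)) • X,
      (Complex.continuous_conj.comp hg).smul continuous_const, rfl⟩
    rw [← ContinuousLinearMap.integral_comp_comm f] at h1
    · have h2 : ∀ s, f (NormedSpace.exp (s • A) * (B ∘L ((starRingEnd ℂ (g s)) • X)))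
          = ((‖g s‖ ^ 2 : ℝ) : ℂ) := fun s => by
        rw [ContinuousLinearMap.comp_smul, mul_smul_comm, map_smul, smul_eq_mul]
        change (starRingEnd ℂ (g s)) * g s = _
        rw [Complex.conj_mul']
        norm_cast
      simp only [h2] at h1
      rw [integral_complex_ofReal, Complex.ofReal_eq_zero, integral_eq_zero_iff_of_nonneg
        (fun _ => by positivity) (Continuous.integrableOn_Ioc (by fun_prop))] at h1
      have h3 := Measure.eqOn_Ioo_of_ae_eq (μ := volume)
        (ae_restrict_of_ae_restrict_of_subset Set.Ioo_subset_Ioc_self h1)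
        (by fun_prop) (by fun_prop)
      intro t ht
      simpa [g] using h3 ht
    · exact Continuous.integrableOn_Ioc (by fun_prop)
  | succ k ih =>
    intro t ht
    have h1 : HasDerivAt (fun s : ℝ => f (NormedSpace.exp (s • A) * (A ^ k * (B ∘L X))))
        (f (NormedSpace.exp (t • A) * A * (A ^ k * (B ∘L X)))) t :=
      (f.restrictScalars ℝ).hasFDerivAt.comp_hasDerivAt t
        ((hasDerivAt_exp_smul_const A t).mul_const _)
    have h2 : (fun s : ℝ => f (NormedSpace.exp (s • A) * (A ^ k * (B ∘L X)))) =ᶠ[nhds t]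
        fun _ => 0 := by
      filter_upwards [isOpen_Ioo.mem_nhds ht] with s hs using ih s hs
    have h3 := h1.unique ((hasDerivAt_const t (0 : ℂ)).congr_of_eventuallyEq h2)
    rw [← h3, pow_succ']
    simp only [mul_assoc]

variable [CompleteSpace U]

theorem ContinuousLinearMap.exists_comp_eq_one_of_surjective {S : U →L[ℂ] H}
    (hS : Function.Surjective S) : ∃ R : H →L[ℂ] U, S ∘L R = 1 := by
  obtain ⟨C, hC, hb⟩ := S.exists_preimage_norm_le hS
  have hunit : IsUnit (S ∘L adjoint S) := by
    refine isUnit_of_le_re_inner (C := C ^ 2) (by positivity) fun φ => ?_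
    obtain ⟨x, hx, hxC⟩ := hb φ
    have h1 : (inner ℂ φ ((S ∘L adjoint S) φ)).re = ‖adjoint S φ‖ ^ 2 := by
      rw [comp_apply, ← adjoint_inner_left, ← inner_self_eq_norm_sq (𝕜 := ℂ)]; rfl
    have h2 : ‖φ‖ ^ 2 ≤ C * ‖φ‖ * ‖adjoint S φ‖ := by
      calc ‖φ‖ ^ 2 = ‖inner ℂ x (adjoint S φ)‖ := by
            rw [adjoint_inner_right, hx, inner_self_eq_norm_sq_to_K]; simp
        _ ≤ ‖x‖ * ‖adjoint S φ‖ := norm_inner_le_norm _ _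
        _ ≤ _ := by gcongr
    rw [h1, ← mul_pow]
    rcases eq_or_ne φ 0 with rfl | hφ
    · simp
    · have : 0 < ‖φ‖ := norm_pos_iff.mpr hφ
      gcongr
      nlinarith
  obtain ⟨u, hu⟩ := hunit
  refine ⟨adjoint S ∘L (↑u⁻¹ : H →L[ℂ] H), ?_⟩
  rw [← comp_assoc, ← hu]
  exact u.mul_inv

theorem exists_hautus_right_inverse_of_surjective {A : H →L[ℂ] H} {B : U →L[ℂ] H} {lam : ℂ}
    (h : ∀ y, ∃ x u, y = lam • x - A x + B u) :
    ∃ (X : H →L[ℂ] H) (Y : H →L[ℂ] U), ∀ y, y = lam • X y - A (X y) + B (Y y) := by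
  let S : WithLp 2 (H × U) →L[ℂ] H :=
    (lam • (1 : H →L[ℂ] H) - A) ∘L WithLp.fstL 2 ℂ H U + B ∘L WithLp.sndL 2 ℂ H U
  obtain ⟨R, hR⟩ := ContinuousLinearMap.exists_comp_eq_one_of_surjective (S := S) fun y => by
    obtain ⟨x, u, rfl⟩ := h y
    exact ⟨WithLp.toLp 2 (x, u), by simp [S]⟩
  refine ⟨WithLp.fstL 2 ℂ H U ∘L R, WithLp.sndL 2 ℂ H U ∘L R, fun y => ?_⟩
  simpa [S] using (DFunLike.congr_fun hR y).symm

theorem hautus_bound_of_surjective {A : H →L[ℂ] H} {B : U →L[ℂ] H} {lam : ℂ}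
    (h : ∀ y, ∃ x u, y = (starRingEnd ℂ lam) • x - A x + B u) :
    ∃ C : ℝ, 0 < C ∧ ∀ φ : H,
      ‖φ‖ ^ 2 ≤ C * (‖lam • φ - (ContinuousLinearMap.adjoint A) φ‖ ^ 2
        + ‖(ContinuousLinearMap.adjoint B) φ‖ ^ 2) := by
  obtain ⟨X, Y, hXY⟩ := exists_hautus_right_inverse_of_surjective h
  refine ⟨2 * (‖X‖ ^ 2 + ‖Y‖ ^ 2 + 1), by positivity, fun φ => ?_⟩
  set a := lam • φ - (ContinuousLinearMap.adjoint A) φ with ha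
  set b := (ContinuousLinearMap.adjoint B) φ with hb
  have h1 : ‖φ‖ ^ 2 ≤ ‖φ‖ * (‖X‖ * ‖a‖ + ‖Y‖ * ‖b‖) := by
    calc ‖φ‖ ^ 2 = ‖inner ℂ φ φ‖ := by rw [inner_self_eq_norm_sq_to_K]; simp
      _ = ‖inner ℂ a (X φ) + inner ℂ b (Y φ)‖ := by
        nth_rw 2 [hXY φ]
        rw [ha, hb, inner_sub_left, ContinuousLinearMap.adjoint_inner_left,
          ContinuousLinearMap.adjoint_inner_left, inner_add_right, inner_sub_right,
          inner_smul_left, inner_smul_right]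
      _ ≤ ‖a‖ * ‖X φ‖ + ‖b‖ * ‖Y φ‖ :=
        (norm_add_le _ _).trans (add_le_add (norm_inner_le_norm _ _) (norm_inner_le_norm _ _))
      _ ≤ ‖a‖ * (‖X‖ * ‖φ‖) + ‖b‖ * (‖Y‖ * ‖φ‖) := by
        gcongr <;> exact ContinuousLinearMap.le_opNorm _ _
      _ = _ := by ring
  have h2 : ‖φ‖ ≤ ‖X‖ * ‖a‖ + ‖Y‖ * ‖b‖ := by
    rcases eq_or_ne φ 0 with h0 | h0
    · rw [h0, norm_zero]; positivity
    · have : 0 < ‖φ‖ := norm_pos_iff.mpr h0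
      nlinarith
  calc ‖φ‖ ^ 2 ≤ (‖X‖ * ‖a‖ + ‖Y‖ * ‖b‖) ^ 2 := by gcongr
    _ ≤ _ := by nlinarith [sq_nonneg (‖X‖ * ‖b‖), sq_nonneg (‖Y‖ * ‖a‖), sq_nonneg ‖a‖,
        sq_nonneg ‖b‖, sq_nonneg (‖X‖ * ‖a‖ - ‖Y‖ * ‖b‖), sq_nonneg (‖X‖ * ‖a‖),
        sq_nonneg (‖Y‖ * ‖b‖)]

theorem exists_right_inverse_of_hautus_bound {A : H →L[ℂ] H} {B : U →L[ℂ] H} {lam : ℂ} {C : ℝ}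
    (hC : 0 < C) (h : ∀ φ : H,
      ‖φ‖ ^ 2 ≤ C * (‖(starRingEnd ℂ lam) • φ - (ContinuousLinearMap.adjoint A) φ‖ ^ 2
        + ‖(ContinuousLinearMap.adjoint B) φ‖ ^ 2)) :
    ∃ (X : H →L[ℂ] H) (Y : H →L[ℂ] U),
      (lam • (1 : H →L[ℂ] H) - A) ∘L X + B ∘L Y = 1 := by
  let D := lam • (1 : H →L[ℂ] H) - A
  have hD : ∀ φ, ContinuousLinearMap.adjoint D φ
      = (starRingEnd ℂ lam) • φ - (ContinuousLinearMap.adjoint A) φ := fun φ => by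
    simp [D, map_sub, ← ContinuousLinearMap.star_eq_adjoint]
  have hunit : IsUnit
      (D ∘L ContinuousLinearMap.adjoint D + B ∘L ContinuousLinearMap.adjoint B) := by
    refine ContinuousLinearMap.isUnit_of_le_re_inner hC fun φ => ?_
    refine (h φ).trans_eq ?_
    rw [← hD, add_apply, inner_add_right, ContinuousLinearMap.comp_apply,
      ContinuousLinearMap.comp_apply, ← ContinuousLinearMap.adjoint_inner_left D,
      ← ContinuousLinearMap.adjoint_inner_left B, ← inner_self_eq_norm_sq (𝕜 := ℂ),
      ← inner_self_eq_norm_sq (𝕜 := ℂ)]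
    rfl
  obtain ⟨u, hu⟩ := hunit
  refine ⟨ContinuousLinearMap.adjoint D ∘L (↑u⁻¹ : H →L[ℂ] H),
    ContinuousLinearMap.adjoint B ∘L (↑u⁻¹ : H →L[ℂ] H), ?_⟩
  rw [← ContinuousLinearMap.comp_assoc, ← ContinuousLinearMap.comp_assoc,
    ← ContinuousLinearMap.add_comp, ← hu]
  exact u.mul_inv

theorem exists_sum_eq_one_of_kalmanSpan_eq_top {A : H →L[ℂ] H} {B : U →L[ℂ] H} {n : ℕ}
    (h : kalmanSpan A B n = ⊤) :
    ∃ X : Fin (n + 1) → H →L[ℂ] U, ∑ k : Fin (n + 1), (A ^ (k : ℕ)) * (B ∘L X k) = 1 := by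
  let S : PiLp 2 (fun _ : Fin (n + 1) => U) →L[ℂ] H :=
    ∑ k : Fin (n + 1), (A ^ (k : ℕ)) ∘L B ∘L PiLp.proj 2 (𝕜 := ℂ) (fun _ : Fin (n + 1) => U) k
  have hS : Function.Surjective S := by
    have : kalmanSpan A B n ≤ S.toLinearMap.range := by
      refine Submodule.span_le.mpr ?_
      rintro _ ⟨k, hk, u, rfl⟩
      refine ⟨WithLp.toLp 2 (Pi.single ⟨k, by omega⟩ u), ?_⟩
      simp only [S, ContinuousLinearMap.coe_coe, sum_apply,
        ContinuousLinearMap.comp_apply, PiLp.proj_apply]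
      rw [Finset.sum_eq_single ⟨k, by omega⟩]
      · simp
      · intro b _ hb
        simp [Pi.single_eq_of_ne hb]
      · simp
    rw [h] at this
    exact LinearMap.range_eq_top.mp (top_le_iff.mp this)
  obtain ⟨R, hR⟩ := ContinuousLinearMap.exists_comp_eq_one_of_surjective hS
  refine ⟨fun k => PiLp.proj 2 (𝕜 := ℂ) (fun _ : Fin (n + 1) => U) k ∘L R, ?_⟩
  rw [← hR]
  ext y
  simp [S]

theorem hautus_surjective_of_controllable {A : H →L[ℂ] H} {B : U →L[ℂ] H} {T : ℝ}
    (h : ∀ y : H, ∃ u : ℝ → U, MemLp u 2 (volume.restrict (Set.Ioc 0 T)) ∧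
      y = ∫ s in Set.Ioc 0 T, NormedSpace.exp ((T - s) • A) (B (u s)))
    (lam : ℂ) (y : H) : ∃ x u, y = lam • x - A x + B u := by
  obtain ⟨c, G, hc, hG, hcG⟩ := exists_exp_real_smul_eq A lam
  obtain ⟨u, hu2, hy⟩ := h y
  have hu : Integrable u (volume.restrict (Set.Ioc 0 T)) := hu2.integrable (by norm_num)
  have hT : Continuous fun s : ℝ => T - s := by fun_prop
  have hx : Integrable (fun s => G (T - s) (B (u s))) (volume.restrict (Set.Ioc 0 T)) :=
    (hG.comp hT).integrable_clm_apply (B.integrable_comp hu)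
  have hv : Integrable (fun s => c (T - s) • u s) (volume.restrict (Set.Ioc 0 T)) :=
    Continuous.integrable_clm_apply (K := fun s => c (T - s) • (1 : U →L[ℂ] U))
      ((hc.comp hT).smul continuous_const) hu
  refine ⟨∫ s in Set.Ioc 0 T, G (T - s) (B (u s)), ∫ s in Set.Ioc 0 T, c (T - s) • u s, ?_⟩
  let D := lam • (1 : H →L[ℂ] H) - A
  change y = D _ + _
  rw [← ContinuousLinearMap.integral_comp_comm D hx, ← ContinuousLinearMap.integral_comp_comm B hv,
    ← integral_add (D.integrable_comp hx) (B.integrable_comp hv), hy]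
  congr 1
  ext s
  rw [hcG, add_apply, map_smul, add_comm]
  rfl

theorem exists_integral_eq_one_of_kalmanSpan_eq_top {A : H →L[ℂ] H} {B : U →L[ℂ] H} {n : ℕ}
    (h : kalmanSpan A B n = ⊤) : ∃ V : ℝ → H →L[ℂ] U, Continuous V ∧
      ∫ s in Set.Ioc (0 : ℝ) 1, NormedSpace.exp (s • A) * (B ∘L V s) = 1 := by
  have hexp := continuous_exp_real_smul A
  obtain ⟨X, hX⟩ := exists_sum_eq_one_of_kalmanSpan_eq_top h
  have h1 : NormedSpace.exp ((1 / 2 : ℝ) • A) ∈ closure (controlIdeal A B : Set (H →L[ℂ] H)) := by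
    by_contra h1
    obtain ⟨f, hf, hne⟩ := (controlIdeal A B).exists_dual_eq_zero_of_notMem_closure h1
    apply hne
    rw [← mul_one (NormedSpace.exp _), ← hX, Finset.mul_sum, map_sum]
    exact Finset.sum_eq_zero fun k _ =>
      eq_zero_of_eq_zero_on_controlIdeal hf (X k) k _ (by norm_num)
  let _ : NormedAlgebra ℚ (H →L[ℂ] H) := NormedAlgebra.restrictScalars ℚ ℂ _
  obtain ⟨_, ⟨u, rfl⟩, V, hV, hu⟩ :=
    mem_closure_iff.mp h1 _ Units.isOpen (NormedSpace.isUnit_exp _)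
  refine ⟨fun s => V s ∘L (↑u⁻¹ : H →L[ℂ] H), by fun_prop, ?_⟩
  have h2 := ((ContinuousLinearMap.mul ℂ (H →L[ℂ] H)).flip (↑u⁻¹ : H →L[ℂ] H)).integral_comp_comm
    (μ := volume.restrict (Set.Ioc (0 : ℝ) 1))
    (φ := fun s => NormedSpace.exp (s • A) * (B ∘L V s))
    (Continuous.integrableOn_Ioc (by fun_prop))
  rw [← hu] at h2
  exact h2.trans u.mul_inv

theorem observable_of_integral_eq_one {A : H →L[ℂ] H} {B : U →L[ℂ] H} {V : ℝ → H →L[ℂ] U}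
    (hV : Continuous V)
    (h : ∫ s in Set.Ioc (0 : ℝ) 1, NormedSpace.exp (s • A) * (B ∘L V s) = 1) :
    ∃ C : ℝ, 0 < C ∧ ∀ φ : H,
      ‖φ‖ ^ 2 ≤ C * ∫ t in Set.Ioc (0 : ℝ) 1, ‖(ContinuousLinearMap.adjoint B)
        (NormedSpace.exp (t • ContinuousLinearMap.adjoint A) φ)‖ ^ 2 := by
  have hexp := continuous_exp_real_smul A
  have hexp' := continuous_exp_real_smul (ContinuousLinearMap.adjoint A)
  obtain ⟨M, hM⟩ := (isCompact_Icc (a := (0 : ℝ)) (b := 1)).exists_bound_of_continuousOn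
    hV.continuousOn
  refine ⟨M ^ 2 + 1, by positivity, fun φ => ?_⟩
  set b : ℝ → U := fun t => (ContinuousLinearMap.adjoint B)
        (NormedSpace.exp (t • ContinuousLinearMap.adjoint A) φ) with hb
  have hbc : Continuous b := by fun_prop
  have h1 : ((‖φ‖ ^ 2 : ℝ) : ℂ) = ∫ s in Set.Ioc (0 : ℝ) 1, inner ℂ (b s) (V s φ) := by
    have h2 := integral_inner (𝕜 := ℂ) (μ := volume.restrict (Set.Ioc (0 : ℝ) 1))
      (f := fun s => NormedSpace.exp (s • A) (B (V s φ)))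
      (Continuous.integrableOn_Ioc (by fun_prop)) φ
    have h3 := ContinuousLinearMap.integral_apply (μ := volume.restrict (Set.Ioc (0 : ℝ) 1))
      (φ := fun s => NormedSpace.exp (s • A) * (B ∘L V s))
      (Continuous.integrableOn_Ioc (by fun_prop)) φ
    rw [h] at h3
    have h4 : φ = ∫ s in Set.Ioc (0 : ℝ) 1, NormedSpace.exp (s • A) (B (V s φ)) := h3
    rw [← h4, inner_self_eq_norm_sq_to_K] at h2
    push_cast
    refine h2.symm.trans (integral_congr_ae (ae_of_all _ fun s => ?_))
    simp only [hb]
    rw [ContinuousLinearMap.adjoint_inner_left, ← ContinuousLinearMap.adjoint_exp_real_smul,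
      ContinuousLinearMap.adjoint_inner_left]
  have h5 : ‖φ‖ ^ 2 ≤ ∫ s in Set.Ioc (0 : ℝ) 1, (‖φ‖ ^ 2 / 2 + M ^ 2 / 2 * ‖b s‖ ^ 2) := by
    have h6 : ‖φ‖ ^ 2 = ‖∫ s in Set.Ioc (0 : ℝ) 1, inner ℂ (b s) (V s φ)‖ := by
      rw [← h1, Complex.norm_real, Real.norm_of_nonneg (by positivity)]
    rw [h6]
    refine norm_integral_le_of_norm_le (Continuous.integrableOn_Ioc (by fun_prop)) ?_
    filter_upwards [ae_restrict_mem measurableSet_Ioc] with s hs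
    rw [← h6]
    have h7 : ‖V s φ‖ ≤ M * ‖φ‖ := (V s).le_of_opNorm_le (hM s ⟨hs.1.le, hs.2⟩) φ
    calc ‖inner ℂ (b s) (V s φ)‖ ≤ ‖b s‖ * ‖V s φ‖ := norm_inner_le_norm _ _
      _ ≤ ‖b s‖ * (M * ‖φ‖) := by gcongr
      _ ≤ _ := by nlinarith [sq_nonneg (M * ‖b s‖ - ‖φ‖)]
  rw [integral_add (by simp) (Continuous.integrableOn_Ioc (by fun_prop)),
    integral_const_mul] at h5
  have h8 : 0 ≤ ∫ s in Set.Ioc (0 : ℝ) 1, ‖b s‖ ^ 2 := integral_nonneg fun _ => by positivity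
  simp at h5
  linarith

theorem controllable_of_observable {A : H →L[ℂ] H} {B : U →L[ℂ] H} {T C : ℝ} (hT : 0 < T)
    (hC : 0 < C) (h : ∀ φ : H,
      ‖φ‖ ^ 2 ≤ C * ∫ t in Set.Ioc 0 T, ‖(ContinuousLinearMap.adjoint B)
        (NormedSpace.exp (t • ContinuousLinearMap.adjoint A) φ)‖ ^ 2) (y : H) :
    ∃ u : ℝ → U, MemLp u 2 (volume.restrict (Set.Ioc 0 T)) ∧
      y = ∫ s in Set.Ioc 0 T, NormedSpace.exp ((T - s) • A) (B (u s)) := by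
  have hexp := continuous_exp_real_smul A
  have hexp' := continuous_exp_real_smul (ContinuousLinearMap.adjoint A)
  let b : ℝ → H →L[ℂ] U := fun t => ContinuousLinearMap.adjoint B ∘L
    NormedSpace.exp (t • ContinuousLinearMap.adjoint A)
  have hb : Continuous b := by fun_prop
  let G : H →L[ℂ] H := ∫ s in Set.Ioc 0 T, NormedSpace.exp (s • A) * (B ∘L b s)
  have hG : ∀ φ, G φ = ∫ s in Set.Ioc 0 T, NormedSpace.exp (s • A) (B (b s φ)) := fun φ =>
    ContinuousLinearMap.integral_apply (μ := volume.restrict (Set.Ioc 0 T))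
      (φ := fun s => NormedSpace.exp (s • A) * (B ∘L b s))
      (Continuous.integrableOn_Ioc (by fun_prop)) φ
  have hunit : IsUnit G := by
    refine ContinuousLinearMap.isUnit_of_le_re_inner hC fun φ => (h φ).trans_eq ?_
    congr 1
    have h1 : inner ℂ φ (G φ) = ((∫ s in Set.Ioc 0 T, ‖b s φ‖ ^ 2 : ℝ) : ℂ) := by
      rw [hG, ← integral_inner (Continuous.integrableOn_Ioc (by fun_prop)),
        ← integral_complex_ofReal]
      refine integral_congr_ae (ae_of_all _ fun s => ?_)
      simp only
      rw [← ContinuousLinearMap.adjoint_inner_left, ContinuousLinearMap.adjoint_exp_real_smul,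
        ← ContinuousLinearMap.adjoint_inner_left]
      change inner ℂ (b s φ) (b s φ) = _
      rw [inner_self_eq_norm_sq_to_K]
      push_cast
      rfl
    rw [h1, Complex.ofReal_re]
    rfl
  obtain ⟨v, hv⟩ := hunit
  let w := (↑v⁻¹ : H →L[ℂ] H) y
  have hw : G w = y := by
    rw [← hv, ← mul_apply_eq_comp, Units.mul_inv, one_apply_eq_self]
  refine ⟨fun s => b (T - s) w, ?_, ?_⟩
  · have hc : Continuous fun s => b (T - s) w := by fun_prop
    obtain ⟨M, hM⟩ := (isCompact_Icc (a := 0) (b := T)).exists_bound_of_continuousOn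
      hc.continuousOn
    refine MemLp.of_bound hc.aestronglyMeasurable M ?_
    filter_upwards [ae_restrict_mem measurableSet_Ioc] with s hs using hM s ⟨hs.1.le, hs.2⟩
  · rw [← hw, hG, ← intervalIntegral.integral_of_le hT.le, ← intervalIntegral.integral_of_le hT.le,
      intervalIntegral.integral_comp_sub_left (fun s => NormedSpace.exp (s • A) (B (b s w)))]
    simp

end Hilbert

/-- Equivalent characterizations of exact controllability for a pair of bounded
operators `A : H →L H`, `B : U →L H` on separable complex Hilbert spaces:
(i) exact controllability at some time `T`;
(ii) the observability inequality at some time `T`;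
(iii) the Kalman-type spanning condition;
(iv) the pointwise Hautus-type inequality for every `λ ∈ ℂ`. -/
theorem controllability_TFAE
    {H U : Type*}
    [NormedAddCommGroup H] [InnerProductSpace ℂ H] [CompleteSpace H]
    [TopologicalSpace.SeparableSpace H]
    [NormedAddCommGroup U] [InnerProductSpace ℂ U] [CompleteSpace U]
    [TopologicalSpace.SeparableSpace U]
    (A : H →L[ℂ] H) (B : U →L[ℂ] H) :
    List.TFAE
      [ -- (i) exact controllability at some time `T > 0`
        ∃ T : ℝ, 0 < T ∧ ∀ y₀ y₁ : H, ∃ u : ℝ → U,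
          MemLp u 2 (volume.restrict (Set.Ioc 0 T)) ∧
          y₁ = NormedSpace.exp (T • A) y₀
              + ∫ s in Set.Ioc 0 T, NormedSpace.exp ((T - s) • A) (B (u s)),
        -- (ii) observability inequality
        ∃ T : ℝ, 0 < T ∧ ∃ C : ℝ, 0 < C ∧ ∀ φ : H,
          ‖φ‖ ^ 2 ≤ C * ∫ t in Set.Ioc 0 T,
            ‖(ContinuousLinearMap.adjoint B)
              (NormedSpace.exp (t • ContinuousLinearMap.adjoint A) φ)‖ ^ 2,
        -- (iii) Kalman-type rank/spanning condition
        ∃ n : ℕ, Submodule.span ℂ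
          {x : H | ∃ k : ℕ, k ≤ n ∧ ∃ u : U, x = (A ^ k) (B u)} = ⊤,
        -- (iv) Hautus-type inequality for every `λ`
        ∀ lam : ℂ, ∃ C : ℝ, 0 < C ∧ ∀ φ : H,
          ‖φ‖ ^ 2 ≤ C * (‖lam • φ - (ContinuousLinearMap.adjoint A) φ‖ ^ 2
            + ‖(ContinuousLinearMap.adjoint B) φ‖ ^ 2) ] := by
  tfae_have 1 → 4 := by
    rintro ⟨T, -, h⟩ lam
    refine hautus_bound_of_surjective (hautus_surjective_of_controllable (T := T) (fun y => ?_) _)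
    obtain ⟨u, hu, hy⟩ := h 0 y
    exact ⟨u, hu, by simpa using hy⟩
  tfae_have 4 → 3 := by
    intro h
    refine kalmanSpan_eq_top_of_hautus fun lam => ?_
    obtain ⟨C, hC, hb⟩ := h (starRingEnd ℂ lam)
    exact exists_right_inverse_of_hautus_bound hC hb
  tfae_have 3 → 2 := by
    rintro ⟨n, h⟩
    obtain ⟨V, hV, h1⟩ := exists_integral_eq_one_of_kalmanSpan_eq_top h
    exact ⟨1, one_pos, observable_of_integral_eq_one hV h1⟩
  tfae_have 2 → 1 := by
    rintro ⟨T, hT, C, hC, h⟩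
    refine ⟨T, hT, fun y₀ y₁ => ?_⟩
    obtain ⟨u, hu, hy⟩ :=
      controllable_of_observable hT hC h (y₁ - NormedSpace.exp (T • A) y₀)
    exact ⟨u, hu, by rw [← hy]; abel⟩
  tfae_finish
end

section
/- Let H and U be separable complex Hilbert spaces, A : H → H a bounded normal operator (i.e. A∘A* = A*∘A) and B : U → H a bounded linear operator. Then the system [A,B] is exponentially stabilizable if and only if the pair (A*,B*) satisfies (HESI)_β for some β > 0. -/
section

open ContinuousLinearMap

theorem norm_le_of_norm_exp_le {H : Type*} [NormedAddCommGroup H] [NormedSpace ℂ H]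
    [CompleteSpace H] (S : H →L[ℂ] H) {M α : ℝ}
    (hS : ∀ t : ℝ, 0 ≤ t → ‖NormedSpace.exp (t • S)‖ ≤ M * Real.exp (-α * t))
    (lam : ℂ) (hlam : -α < lam.re) (φ : H) :
    ‖φ‖ ≤ M / (lam.re + α) * ‖lam • φ - S φ‖ := by
  set γ := lam.re + α with hγ
  have hγ0 : 0 < γ := by linarith
  set y := lam • φ - S φ with hy
  set u : ℝ → H := fun t => Complex.exp (-lam * t) • NormedSpace.exp (t • S) φ with hu
  have hnorm : ∀ t : ℝ, 0 ≤ t → ∀ x : H,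
      ‖Complex.exp (-lam * t) • NormedSpace.exp (t • S) x‖
        ≤ M * Real.exp (-γ * t) * ‖x‖ := by
    intro t ht x
    have h1 : ‖Complex.exp (-lam * t)‖ = Real.exp (-lam.re * t) := by
      rw [Complex.norm_exp]; simp
    have h2 : Real.exp (-γ * t) = Real.exp (-lam.re * t) * Real.exp (-α * t) := by
      rw [← Real.exp_add]; congr 1; rw [hγ]; ring
    rw [norm_smul, h1, h2]
    calc _ ≤ Real.exp (-lam.re * t) * (M * Real.exp (-α * t) * ‖x‖) := by
          gcongr
          exact (le_opNorm _ _).trans (by gcongr; exact hS t ht)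
      _ = _ := by ring
  have hderiv : ∀ t : ℝ, HasDerivAt u
      (-(Complex.exp (-lam * t) • NormedSpace.exp (t • S) y)) t := by
    intro t
    have h1 : HasDerivAt (fun t : ℝ => Complex.exp (-lam * t))
        (Complex.exp (-lam * t) * -lam) t := by
      have : HasDerivAt (fun t : ℝ => -lam * (t : ℂ)) (-lam) t := by
        simpa using (Complex.ofRealCLM.hasDerivAt (x := t)).const_mul (-lam)
      exact this.cexp
    have h2 : HasDerivAt (fun t : ℝ => NormedSpace.exp (t • S) φ)
        ((NormedSpace.exp (t • S) * S) φ) t :=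
      (((ContinuousLinearMap.apply ℂ H φ).restrictScalars ℝ).hasFDerivAt).comp_hasDerivAt t
        (hasDerivAt_exp_smul_const S t)
    convert! h1.smul h2 using 1
    simp only [hy, map_sub, map_smul, smul_sub, smul_smul, mul_neg, neg_smul]
    abel
  have hbound : ∀ t : ℝ, 0 ≤ t → ‖u t - φ‖ ≤ M / γ * (1 - Real.exp (-γ * t)) * ‖y‖ := by
    intro t ht
    refine image_norm_le_of_norm_deriv_right_le_deriv_boundary (f := fun t => u t - φ)
      (a := 0) (b := t) (B := fun t => M / γ * (1 - Real.exp (-γ * t)) * ‖y‖)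
      (B' := fun t => M * Real.exp (-γ * t) * ‖y‖) ?_
      (fun x _ => ((hderiv x).sub_const φ).hasDerivWithinAt) (by simp [hu]) ?_ ?_ ⟨ht, le_rfl⟩
    · exact fun x _ => ((hderiv x).sub_const φ).continuousAt.continuousWithinAt
    · intro x
      have h1 : HasDerivAt (fun x : ℝ => -γ * x) (-γ) x := by
        simpa using (hasDerivAt_id x).const_mul (-γ)
      convert! ((h1.exp.const_sub 1).const_mul (M / γ)).mul_const ‖y‖ using 1
      field_simp
    · intro x hx
      rw [norm_neg]
      exact hnorm x hx.1 y
  have hM : 0 ≤ M := by simpa using (norm_nonneg _).trans (hS 0 le_rfl)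
  have hlim : Filter.Tendsto (fun t : ℝ => M * Real.exp (-γ * t) * ‖φ‖ + M / γ * ‖y‖)
      Filter.atTop (nhds (M * 0 * ‖φ‖ + M / γ * ‖y‖)) := by
    refine (((Real.tendsto_exp_atBot.comp ?_).const_mul M).mul_const ‖φ‖).add_const _
    exact Filter.tendsto_id.const_mul_atTop_of_neg (neg_neg_of_pos hγ0)
  have := ge_of_tendsto hlim (b := ‖φ‖) <| by
    filter_upwards [Filter.eventually_ge_atTop 0] with t ht
    have h1 : ‖φ‖ ≤ ‖u t‖ + ‖u t - φ‖ := by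
      simpa [norm_sub_rev] using norm_sub_le (u t) (u t - φ)
    have h2 : M / γ * (1 - Real.exp (-γ * t)) * ‖y‖ ≤ M / γ * 1 * ‖y‖ := by
      have := Real.exp_pos (-γ * t)
      gcongr
      linarith
    linarith [hnorm t ht φ, hbound t ht]
  simpa using this

/-- A closed loop that decays exponentially gives the frequency-domain estimate for the
adjoint pair. -/
theorem hautus_estimate_of_norm_exp_le {H U : Type*}
    [NormedAddCommGroup H] [InnerProductSpace ℂ H] [CompleteSpace H]
    [NormedAddCommGroup U] [InnerProductSpace ℂ U] [CompleteSpace U]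
    (A : H →L[ℂ] H) (B : U →L[ℂ] H) (K : H →L[ℂ] U) {M α : ℝ}
    (hS : ∀ t : ℝ, 0 ≤ t →
      ‖NormedSpace.exp (t • (A + B ∘L K))‖ ≤ M * Real.exp (-α * t))
    (lam : ℂ) (hlam : -α < lam.re) (φ : H) :
    ‖φ‖ ^ 2 ≤ 2 * M ^ 2 * (1 + ‖K‖ ^ 2) / (lam.re + α) ^ 2 *
      (‖lam • φ - adjoint A φ‖ ^ 2 + ‖adjoint B φ‖ ^ 2) := by
  have hγ0 : 0 < lam.re + α := by linarith
  have hM : 0 ≤ M := by simpa using (norm_nonneg _).trans (hS 0 le_rfl)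
  have h1 := norm_le_of_norm_exp_le (adjoint (A + B ∘L K)) (M := M) (α := α) (fun t ht => by
    have : NormedSpace.exp (t • adjoint (A + B ∘L K))
        = star (NormedSpace.exp (t • (A + B ∘L K))) := by
      rw [NormedSpace.star_exp, star_smul, star_trivial]; rfl
    rw [this, norm_star]
    exact hS t ht) lam hlam φ
  have h2 : ‖lam • φ - adjoint (A + B ∘L K) φ‖
      ≤ ‖lam • φ - adjoint A φ‖ + ‖K‖ * ‖adjoint B φ‖ := by
    have : lam • φ - adjoint (A + B ∘L K) φ
        = (lam • φ - adjoint A φ) - adjoint K (adjoint B φ) := by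
      simp [adjoint_comp, sub_sub]
    rw [this]
    refine (norm_sub_le _ _).trans ?_
    gcongr
    simpa using (adjoint K).le_opNorm (adjoint B φ)
  set x := ‖lam • φ - adjoint A φ‖
  set z := ‖adjoint B φ‖
  have h3 : ‖φ‖ ≤ M / (lam.re + α) * (x + ‖K‖ * z) := h1.trans (by gcongr)
  calc ‖φ‖ ^ 2 ≤ (M / (lam.re + α) * (x + ‖K‖ * z)) ^ 2 := by gcongr
    _ = (M / (lam.re + α)) ^ 2 * (x + ‖K‖ * z) ^ 2 := by ring
    _ ≤ (M / (lam.re + α)) ^ 2 * (2 * (1 + ‖K‖ ^ 2) * (x ^ 2 + z ^ 2)) := by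
        gcongr
        nlinarith [sq_nonneg (x - ‖K‖ * z), sq_nonneg x, sq_nonneg z, sq_nonneg (‖K‖ * x)]
    _ = _ := by rw [div_pow]; ring

/-- A bounded Lyapunov operator for the adjoint pair yields a stabilizing feedback. -/
theorem exists_feedback_of_lyapunov {H U : Type*}
    [NormedAddCommGroup H] [InnerProductSpace ℂ H] [CompleteSpace H]
    [NormedAddCommGroup U] [InnerProductSpace ℂ U] [CompleteSpace U]
    (A : H →L[ℂ] H) (B : U →L[ℂ] H) (W : H →L[ℂ] H) (hW : IsSelfAdjoint W)
    {δ e c : ℝ} (hδ : 0 < δ) (he : 0 < e)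
    (hcoer : ∀ φ, δ * ‖φ‖ ^ 2 ≤ (inner ℂ (W φ) φ).re)
    (hlyap : ∀ φ, (inner ℂ (W φ) (adjoint A φ)).re + e * (inner ℂ (W φ) φ).re
      ≤ c * ‖adjoint B φ‖ ^ 2) :
    ∃ K : H →L[ℂ] U, ∃ M : ℝ, 0 < M ∧ ∃ α : ℝ, 0 < α ∧
      ∀ t : ℝ, 0 ≤ t →
        ‖NormedSpace.exp (t • (A + B ∘L K))‖ ≤ M * Real.exp (-α * t) := by
  have hunit : IsUnit W := by
    refine isUnit_of_forall_le_norm_inner_map W (c := ⟨δ, hδ.le⟩) hδ fun x => ?_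
    calc ‖x‖ ^ 2 * δ ≤ (inner ℂ (W x) x).re := by linarith [hcoer x]
      _ ≤ _ := Complex.re_le_norm _
  obtain ⟨Z, hZ⟩ := hunit.exists_right_inv
  have hWZ : ∀ x, W (Z x) = x := fun x => DFunLike.congr_fun hZ x
  have hsym : ∀ x y, inner ℂ (W x) y = inner ℂ x (W y) := fun x y =>
    (isSelfAdjoint_iff_isSymmetric.mp hW) x y
  have hZsym : ∀ x y, inner ℂ (Z x) y = inner ℂ x (Z y) := fun x y => by
    conv_lhs => rw [← hWZ y]
    rw [← hsym, hWZ]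
  have hZn : ∀ x, δ * ‖Z x‖ ≤ ‖x‖ := by
    intro x
    rcases eq_or_ne (Z x) 0 with h | h
    · simp [h]
    have h0 : 0 < ‖Z x‖ := norm_pos_iff.mpr h
    have h1 := hcoer (Z x)
    rw [hWZ] at h1
    have h2 : (inner ℂ x (Z x)).re ≤ ‖x‖ * ‖Z x‖ :=
      (Complex.re_le_norm _).trans (norm_inner_le_norm _ _)
    nlinarith
  set K : H →L[ℂ] U := (-c : ℂ) • (adjoint B ∘L Z)
  set S := A + B ∘L K
  have hdiss : ∀ x, (inner ℂ (Z x) (S x)).re ≤ -e * (inner ℂ (Z x) x).re := by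
    intro x
    have h1 := hlyap (Z x)
    rw [hWZ] at h1
    have h2 : inner ℂ (Z x) (S x)
        = inner ℂ (adjoint A (Z x)) x - c * (‖adjoint B (Z x)‖ : ℂ) ^ 2 := by
      have h0 : inner ℂ (Z x) (B (adjoint B (Z x))) = (‖adjoint B (Z x)‖ : ℂ) ^ 2 := by
        rw [← adjoint_inner_left]
        exact inner_self_eq_norm_sq_to_K (𝕜 := ℂ) _
      rw [← h0, adjoint_inner_left]
      have h6 : S x = A x - (c : ℂ) • B (adjoint B (Z x)) := by
        simp [S, K, sub_eq_add_neg]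
      rw [h6, inner_sub_right, inner_smul_right]
    rw [h2]
    have h3 : (inner ℂ (adjoint A (Z x)) x).re = (inner ℂ x (adjoint A (Z x))).re :=
      inner_re_symm (𝕜 := ℂ) _ _
    have h4 : (inner ℂ (Z x) x).re = (inner ℂ x (Z x)).re := inner_re_symm (𝕜 := ℂ) _ _
    have h5 : ((c : ℂ) * (‖adjoint B (Z x)‖ : ℂ) ^ 2).re = c * ‖adjoint B (Z x)‖ ^ 2 := by
      norm_cast
    rw [Complex.sub_re, h3, h4, h5]
    linarith
  refine ⟨K, ‖W‖ / δ + 1, by positivity, e, he, fun t ht => ?_⟩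
  refine opNorm_le_bound _ (by positivity) fun x => ?_
  set u : ℝ → H := fun t => NormedSpace.exp (t • S) x with hu
  have hud : ∀ t, HasDerivAt u (S (u t)) t := fun t =>
    (((ContinuousLinearMap.apply ℂ H x).restrictScalars ℝ).hasFDerivAt).comp_hasDerivAt t
        (hasDerivAt_exp_smul_const' S t)
  set V : ℝ → ℝ := fun t => Real.exp (2 * e * t) * (inner ℂ (Z (u t)) (u t)).re with hV
  have hVd : ∀ t, HasDerivAt V (Real.exp (2 * e * t) * (2 * e) * (inner ℂ (Z (u t)) (u t)).re
      + Real.exp (2 * e * t) * (2 * (inner ℂ (Z (u t)) (S (u t))).re)) t := by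
    intro t
    have h1 : HasDerivAt (fun t : ℝ => Real.exp (2 * e * t)) (Real.exp (2 * e * t) * (2 * e)) t := by
      have : HasDerivAt (fun t : ℝ => 2 * e * t) (2 * e) t := by
        simpa using (hasDerivAt_id t).const_mul (2 * e)
      exact this.exp
    have h2 : HasDerivAt (fun t => Z (u t)) (Z (S (u t))) t :=
      ((Z.restrictScalars ℝ).hasFDerivAt).comp_hasDerivAt t (hud t)
    have h3 := (Complex.reCLM.hasFDerivAt).comp_hasDerivAt t (h2.inner ℂ (hud t))
    convert! h1.mul h3 using 1
    have h4 : (inner ℂ (Z (S (u t))) (u t)).re = (inner ℂ (Z (u t)) (S (u t))).re := by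
      rw [hZsym]; exact inner_re_symm (𝕜 := ℂ) _ _
    simp only [Complex.reCLM_apply, Complex.add_re, Function.comp, h4]
    ring
  have hanti : Antitone V := by
    refine antitone_of_deriv_nonpos (fun t => (hVd t).differentiableAt) fun t => ?_
    rw [(hVd t).deriv]
    have := hdiss (u t)
    have := Real.exp_pos (2 * e * t)
    nlinarith
  have hV0 : V t ≤ V 0 := hanti ht
  have hlow : δ * ‖u t‖ ^ 2 ≤ ‖W‖ ^ 2 * (inner ℂ (Z (u t)) (u t)).re := by
    have h1 := hcoer (Z (u t))
    rw [hWZ] at h1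
    have h2 : ‖u t‖ ≤ ‖W‖ * ‖Z (u t)‖ := by
      conv_lhs => rw [← hWZ (u t)]
      exact W.le_opNorm _
    have h3 : (inner ℂ (Z (u t)) (u t)).re = (inner ℂ (u t) (Z (u t))).re :=
      inner_re_symm (𝕜 := ℂ) _ _
    rw [h3]
    calc δ * ‖u t‖ ^ 2 ≤ δ * (‖W‖ * ‖Z (u t)‖) ^ 2 := by gcongr
      _ = ‖W‖ ^ 2 * (δ * ‖Z (u t)‖ ^ 2) := by ring
      _ ≤ _ := by gcongr
  have hup : δ * V 0 ≤ ‖x‖ ^ 2 := by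
    have h1 : V 0 = (inner ℂ (Z x) x).re := by simp [hV, hu]
    have h2 : (inner ℂ (Z x) x).re ≤ ‖Z x‖ * ‖x‖ :=
      (Complex.re_le_norm _).trans (norm_inner_le_norm _ _)
    rw [h1]
    nlinarith [hZn x, norm_nonneg x]
  have hE : Real.exp (2 * e * t) * Real.exp (-e * t) ^ 2 = 1 := by
    rw [← Real.exp_nat_mul, ← Real.exp_add]; norm_num; ring
  have hfin : ‖u t‖ ^ 2 ≤ (‖W‖ / δ * Real.exp (-e * t) * ‖x‖) ^ 2 := by
    have hEp := Real.exp_pos (-e * t)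
    calc ‖u t‖ ^ 2 = (δ * ‖u t‖ ^ 2) * (Real.exp (2 * e * t) * Real.exp (-e * t) ^ 2) / δ := by
          rw [hE]; field_simp
      _ ≤ (‖W‖ ^ 2 * (inner ℂ (Z (u t)) (u t)).re) *
          (Real.exp (2 * e * t) * Real.exp (-e * t) ^ 2) / δ := by gcongr
      _ = ‖W‖ ^ 2 * Real.exp (-e * t) ^ 2 * V t / δ := by simp only [hV]; ring
      _ ≤ ‖W‖ ^ 2 * Real.exp (-e * t) ^ 2 * V 0 / δ := by gcongr
      _ = ‖W‖ ^ 2 * Real.exp (-e * t) ^ 2 * (δ * V 0) / δ ^ 2 := by field_simp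
      _ ≤ ‖W‖ ^ 2 * Real.exp (-e * t) ^ 2 * ‖x‖ ^ 2 / δ ^ 2 := by gcongr
      _ = _ := by ring
  have := (sq_le_sq₀ (norm_nonneg _) (by positivity)).mp hfin
  refine this.trans ?_
  gcongr
  linarith

/-- Discrete Parseval identity for a vector-valued finite Fourier transform. -/
theorem sum_norm_sq_sum_pow_smul {E : Type*} [NormedAddCommGroup E] [InnerProductSpace ℂ E]
    {n : ℕ} (hn : n ≠ 0) {ζ : ℂ} (hζ : IsPrimitiveRoot ζ n) (v : ℕ → E) :
    ∑ j ∈ Finset.range n, ‖∑ k ∈ Finset.range n, (ζ ^ j) ^ k • v k‖ ^ 2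
      = n * ∑ k ∈ Finset.range n, ‖v k‖ ^ 2 := by
  have hnorm : ‖ζ‖ = 1 := hζ.norm'_eq_one hn
  have hζ0 : ζ ≠ 0 := by rintro rfl; simp at hnorm
  have hconj : (starRingEnd ℂ) ζ = ζ⁻¹ := by
    rw [Complex.inv_def, Complex.normSq_eq_norm_sq, hnorm]; simp
  have horth : ∀ k ∈ Finset.range n, ∀ l ∈ Finset.range n,
      ∑ j ∈ Finset.range n, (starRingEnd ℂ) ((ζ ^ j) ^ k) * (ζ ^ j) ^ l
        = if k = l then (n : ℂ) else 0 := by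
    intro k hk l hl
    rw [Finset.mem_range] at hk hl
    have h1 : ∀ j, (starRingEnd ℂ) ((ζ ^ j) ^ k) * (ζ ^ j) ^ l = (ζ⁻¹ ^ k * ζ ^ l) ^ j := by
      intro j
      simp only [map_pow, hconj]
      ring
    simp only [h1]
    split_ifs with h
    · subst h
      simp [hζ0]
    · set w := ζ⁻¹ ^ k * ζ ^ l with hw
      have hw1 : w ≠ 1 := by
        intro hw'
        apply h
        refine hζ.pow_inj hk hl ?_
        rw [hw, inv_pow, inv_mul_eq_one₀ (pow_ne_zero _ hζ0)] at hw'
        exact hw'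
      have hwn : w ^ n = 1 := by
        rw [hw, mul_pow, ← pow_mul, ← pow_mul, mul_comm k, mul_comm l, pow_mul, pow_mul,
          inv_pow, hζ.pow_eq_one]
        simp
      have := geom_sum_mul w n
      rw [hwn, sub_self] at this
      exact (mul_eq_zero.mp this).resolve_right (sub_ne_zero.mpr hw1)
  have key : ∑ j ∈ Finset.range n, inner ℂ (∑ k ∈ Finset.range n, (ζ ^ j) ^ k • v k)
      (∑ k ∈ Finset.range n, (ζ ^ j) ^ k • v k)
      = n * ∑ k ∈ Finset.range n, inner ℂ (v k) (v k) := by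
    simp only [sum_inner, inner_sum, inner_smul_left, inner_smul_right, Finset.mul_sum]
    rw [Finset.sum_comm]
    refine Finset.sum_congr rfl fun k hk => ?_
    rw [Finset.sum_comm]
    rw [Finset.sum_eq_single_of_mem k hk]
    · rw [← (horth k hk k hk).trans (if_pos rfl), Finset.sum_mul]
      exact Finset.sum_congr rfl fun j _ => by ring
    · intro l hl hlk
      have := horth l hl k hk
      rw [if_neg hlk] at this
      rw [← zero_mul (inner ℂ (v l) (v k)), ← this, Finset.sum_mul]
      exact Finset.sum_congr rfl fun j _ => by ring
  have hself : ∀ x : E, inner ℂ x x = ((‖x‖ ^ 2 : ℝ) : ℂ) := fun x => by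
    rw [inner_self_eq_norm_sq_to_K]; push_cast; rfl
  simp only [hself] at key
  exact_mod_cast key

/-- A positive log-convex sequence with ratios in `[q, s]`, `s ≤ 1`, has within a uniformly bounded
range a block of length `n` along which it is geometric up to a factor `2`. -/
theorem exists_almost_geometric_block {q : ℝ} (hq : 0 < q) (n : ℕ) :
    ∃ L : ℕ, ∀ (s : ℝ) (a : ℕ → ℝ), s ≤ 1 → (∀ k, 0 < a k) → (∀ k, q * a k ≤ a (k + 1)) →
      (∀ k, a (k + 1) ≤ s * a k) → (∀ k, a (k + 1) ^ 2 ≤ a k * a (k + 2)) →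
      ∃ m < L, ∃ ρ, q ≤ ρ ∧ ρ ≤ s ∧ (∀ k, ρ ^ k * a m ≤ a (m + k)) ∧
        a (m + n) ≤ 2 * ρ ^ n * a m := by
  obtain ⟨L, hL⟩ := pow_unbounded_of_one_lt ((q ^ n)⁻¹) (one_lt_two (α := ℝ))
  refine ⟨L * n + 1, fun s a hs ha hqa hsa hconv => ?_⟩
  set r : ℕ → ℝ := fun k => a (k + 1) / a k with hr
  have hra : ∀ k, a (k + 1) = r k * a k := fun k => by
    rw [hr]; field_simp [(ha k).ne']
  have hr0 : ∀ k, 0 < r k := fun k => div_pos (ha _) (ha _)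
  have hrq : ∀ k, q ≤ r k := fun k => (le_div_iff₀ (ha k)).mpr (hqa k)
  have hrs : ∀ k, r k ≤ s := fun k => (div_le_iff₀ (ha k)).mpr (hsa k)
  have hmono : Monotone r := monotone_nat_of_le_succ fun k => by
    rw [hr]
    simp only
    rw [div_le_div_iff₀ (ha _) (ha _)]
    nlinarith [hconv k]
  have hlow : ∀ m k, r m ^ k * a m ≤ a (m + k) := by
    intro m k
    induction k with
    | zero => simp
    | succ k ih =>
      rw [← add_assoc, hra (m + k), pow_succ']
      calc r m * r m ^ k * a m = r m * (r m ^ k * a m) := by ring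
        _ ≤ r (m + k) * a (m + k) := by
          have := ha m
          have := hr0 m
          gcongr
          · exact (hr0 _).le
          · exact hmono (by omega)
  have hup : ∀ m k, k ≤ n → a (m + k) ≤ r (m + n) ^ k * a m := by
    intro m k hk
    induction k with
    | zero => simp
    | succ k ih =>
      rw [← add_assoc, hra (m + k), pow_succ']
      calc _ ≤ r (m + n) * (r (m + n) ^ k * a m) := by
            have := (ha (m + k)).le
            have := (hr0 (m + n)).le
            gcongr
            · exact hmono (by omega)
            · exact ih (by omega)
        _ = _ := by ring
  by_contra! hcon
  have hfail : ∀ i ≤ L, 2 ^ i * q ^ n ≤ r (i * n) ^ n := by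
    intro i hi
    induction i with
    | zero => simpa using pow_le_pow_left₀ hq.le (hrq 0) n
    | succ i ih =>
      have h1 := hcon (i * n) (by nlinarith) (r (i * n)) (hrq _) (hrs _) (hlow _)
      have h2 := h1.trans_le (hup (i * n) n le_rfl)
      have h3 := lt_of_mul_lt_mul_right h2 (ha _).le
      have h4 := ih (by omega)
      rw [add_mul, one_mul, pow_succ]
      linarith
  have h1 := hfail L le_rfl
  have h2 : r (L * n) ^ n ≤ 1 := pow_le_one₀ (hr0 _).le ((hrs _).trans hs)
  have h3 : 1 < 2 ^ L * q ^ n := by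
    rwa [inv_lt_iff_one_lt_mul₀ (by positivity)] at hL
  linarith


theorem norm_apply_sq_le_of_commute_adjoint {H : Type*}
    [NormedAddCommGroup H] [InnerProductSpace ℂ H] [CompleteSpace H]
    {T : H →L[ℂ] H} (hT : Commute T (adjoint T)) (x : H) :
    ‖T x‖ ^ 2 ≤ ‖x‖ * ‖T (T x)‖ := by
  have hsq : ∀ S : H →L[ℂ] H, ∀ y : H, ‖S y‖ ^ 2 = (inner ℂ y (adjoint S (S y))).re := by
    intro S y
    rw [adjoint_inner_right]
    exact norm_sq_eq_re_inner (𝕜 := ℂ) _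
  have h1 : ‖adjoint T (T x)‖ = ‖T (T x)‖ := by
    rw [← sq_eq_sq₀ (norm_nonneg _) (norm_nonneg _), hsq, hsq, adjoint_adjoint]
    congr 2
    exact DFunLike.congr_fun hT (T x)
  rw [hsq, ← h1]
  exact (Complex.re_le_norm _).trans (norm_inner_le_norm _ _)

/-- For a normal operator `T` bounded above and below, every orbit contains, after a uniformly
bounded number of steps, a combination which is an approximate eigenvector of `T`. -/
theorem exists_approx_eigenvector {H : Type*}
    [NormedAddCommGroup H] [InnerProductSpace ℂ H] [CompleteSpace H]
    (T : H →L[ℂ] H) (hT : Commute T (adjoint T)) {q s : ℝ} (hq : 0 < q) (hs0 : 0 ≤ s)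
    (hs : s ≤ 1) (hTq : ∀ x, q * ‖x‖ ≤ ‖T x‖) (hTs : ∀ x, ‖T x‖ ≤ s * ‖x‖)
    {r : ℝ} (hr : 0 < r) :
    ∃ (L n : ℕ) (δ : ℝ), 0 < δ ∧ ∀ ψ : H, ∃ m < L, ∃ (lam : ℂ) (c : ℕ → ℂ), ‖lam‖ ≤ s ∧
      (∀ k, ‖c k‖ ≤ 1) ∧
      δ * ‖ψ‖ ≤ ‖∑ k ∈ Finset.range n, c k • (T ^ (m + k)) ψ‖ ∧
      ‖T (∑ k ∈ Finset.range n, c k • (T ^ (m + k)) ψ)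
          - lam • ∑ k ∈ Finset.range n, c k • (T ^ (m + k)) ψ‖
        ≤ r * ‖∑ k ∈ Finset.range n, c k • (T ^ (m + k)) ψ‖ := by
  obtain ⟨n₀, hn₀⟩ := exists_nat_ge (9 / r ^ 2)
  set n := n₀ + 1 with hn
  have hn0 : n ≠ 0 := by omega
  have hnr : 9 ≤ r ^ 2 * n := by
    rw [div_le_iff₀ (by positivity)] at hn₀
    have : (n : ℝ) = n₀ + 1 := by rw [hn]; push_cast; rfl
    rw [this]
    nlinarith [sq_nonneg r]
  obtain ⟨L, hL⟩ := exists_almost_geometric_block hq n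
  refine ⟨L + 1, n, q ^ n₀ * q ^ L, by positivity, fun ψ => ?_⟩
  rcases eq_or_ne ψ 0 with rfl | hψ
  · exact ⟨0, by omega, 0, 0, by simpa using hs0, by simp, by simp, by simp⟩
  have hsucc : ∀ k, (T ^ (k + 1)) ψ = T ((T ^ k) ψ) := fun k => by rw [pow_succ']; rfl
  have hlow : ∀ k, q * ‖(T ^ k) ψ‖ ≤ ‖(T ^ (k + 1)) ψ‖ := fun k => by
    rw [hsucc]; exact hTq _
  have hpos : ∀ k, 0 < ‖(T ^ k) ψ‖ := by
    intro k
    induction k with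
    | zero => simpa using hψ
    | succ k ih => exact (mul_pos hq ih).trans_le (hlow k)
  obtain ⟨m, hmL, ρ, hqρ, hρs, hρlow, hρup⟩ := hL s (fun k => ‖(T ^ k) ψ‖) hs hpos hlow
    (fun k => by rw [hsucc]; exact hTs _)
    (fun k => by
      rw [hsucc (k + 1), hsucc k]
      exact norm_apply_sq_le_of_commute_adjoint hT _)
  have hρ0 : 0 < ρ := hq.trans_le hqρ
  have hρ1 : ρ ≤ 1 := hρs.trans hs
  obtain ⟨ζ, hζ⟩ : ∃ ζ : ℂ, IsPrimitiveRoot ζ n := ⟨_, Complex.isPrimitiveRoot_exp n hn0⟩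
  have hζ1 : ‖ζ‖ = 1 := hζ.norm'_eq_one hn0
  have hζ0 : ζ ≠ 0 := by rintro rfl; simp at hζ1
  have hpars := sum_norm_sq_sum_pow_smul hn0 hζ
    (fun k => ((ρ : ℂ) ^ (n₀ - k)) • (T ^ (m + k)) ψ)
  have hterm : ∀ k ∈ Finset.range n, (ρ ^ n₀ * ‖(T ^ m) ψ‖) ^ 2
      ≤ ‖((ρ : ℂ) ^ (n₀ - k)) • (T ^ (m + k)) ψ‖ ^ 2 := by
    intro k hk
    have hk' : k ≤ n₀ := by rw [Finset.mem_range] at hk; omega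
    gcongr
    rw [norm_smul, norm_pow, Complex.norm_real, Real.norm_of_nonneg hρ0.le]
    calc ρ ^ n₀ * ‖(T ^ m) ψ‖ = ρ ^ (n₀ - k) * (ρ ^ k * ‖(T ^ m) ψ‖) := by
          rw [← mul_assoc, ← pow_add, Nat.sub_add_cancel hk']
      _ ≤ _ := by gcongr; exact hρlow k
  have hsum := Finset.sum_le_sum hterm
  have htotal : ∑ j ∈ Finset.range n, (n : ℝ) * (ρ ^ n₀ * ‖(T ^ m) ψ‖) ^ 2
      ≤ ∑ j ∈ Finset.range n, ‖∑ k ∈ Finset.range n,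
        (ζ ^ j) ^ k • ((ρ : ℂ) ^ (n₀ - k)) • (T ^ (m + k)) ψ‖ ^ 2 := by
    rw [hpars]
    simp only [Finset.sum_const, Finset.card_range, nsmul_eq_mul] at hsum ⊢
    gcongr
  obtain ⟨j, -, hj⟩ := Finset.exists_le_of_sum_le (by simp [hn0]) htotal
  set w : ℂ := (ζ ^ j)⁻¹ with hw
  have hw1 : ‖w‖ = 1 := by rw [hw, norm_inv, norm_pow, hζ1]; simp
  have hw0 : w ≠ 0 := by rw [hw]; exact inv_ne_zero (pow_ne_zero _ hζ0)
  set lam : ℂ := ρ * w with hlam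
  have hlamn : ‖lam‖ = ρ := by
    rw [hlam, norm_mul, hw1, mul_one, Complex.norm_real, Real.norm_of_nonneg hρ0.le]
  set χ := ∑ k ∈ Finset.range n, lam ^ (n₀ - k) • (T ^ (m + k)) ψ with hχ
  have hχn : ‖χ‖ = ‖∑ k ∈ Finset.range n,
      (ζ ^ j) ^ k • ((ρ : ℂ) ^ (n₀ - k)) • (T ^ (m + k)) ψ‖ := by
    have : χ = w ^ n₀ • ∑ k ∈ Finset.range n,
        (ζ ^ j) ^ k • ((ρ : ℂ) ^ (n₀ - k)) • (T ^ (m + k)) ψ := by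
      rw [hχ, Finset.smul_sum]
      refine Finset.sum_congr rfl fun k hk => ?_
      have hk' : k ≤ n₀ := by rw [Finset.mem_range] at hk; omega
      have h1 : ζ ^ j = w⁻¹ := by rw [hw, inv_inv]
      rw [smul_smul, smul_smul, h1, hlam, mul_pow]
      congr 1
      have h2 : w ^ n₀ = w ^ (n₀ - k) * w ^ k := by rw [← pow_add, Nat.sub_add_cancel hk']
      have h3 : w ^ k * (w ^ k)⁻¹ = 1 := mul_inv_cancel₀ (pow_ne_zero _ hw0)
      rw [h2, inv_pow]
      linear_combination -((ρ : ℂ) ^ (n₀ - k) * w ^ (n₀ - k)) * h3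
    rw [this, norm_smul, norm_pow, hw1]
    simp
  rw [← hχn] at hj
  have htel : T χ - lam • χ = (T ^ (m + n)) ψ - lam ^ n • (T ^ m) ψ := by
    have := Finset.sum_range_sub (fun k => lam ^ (n - k) • (T ^ (m + k)) ψ) n
    simp only [Nat.sub_self, pow_zero, one_smul, Nat.sub_zero, add_zero] at this
    rw [← this, hχ, map_sum, Finset.smul_sum, ← Finset.sum_sub_distrib]
    refine Finset.sum_congr rfl fun k hk => ?_
    have hk' : k ≤ n₀ := by rw [Finset.mem_range] at hk; omega
    have h1 : n - (k + 1) = n₀ - k := by omega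
    have h2 : n - k = (n₀ - k) + 1 := by omega
    rw [h1, h2, map_smul, ← add_assoc, hsucc, pow_succ', smul_smul]
  have hχlow : ρ ^ n₀ * ‖(T ^ m) ψ‖ ≤ ‖χ‖ := by
    refine (sq_le_sq₀ (by positivity) (norm_nonneg _)).mp (le_trans ?_ hj)
    have : (1 : ℝ) ≤ n := by exact_mod_cast Nat.one_le_iff_ne_zero.mpr hn0
    nlinarith [sq_nonneg (ρ ^ n₀ * ‖(T ^ m) ψ‖)]
  refine ⟨m, by omega, lam, fun k => lam ^ (n₀ - k), hlamn.trans_le hρs, fun k => ?_, ?_, ?_⟩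
  · rw [norm_pow, hlamn]
    exact pow_le_one₀ hρ0.le hρ1
  · refine le_trans ?_ hχlow
    have h1 : ∀ k, q ^ k * ‖ψ‖ ≤ ‖(T ^ k) ψ‖ := by
      intro k
      induction k with
      | zero => simp
      | succ k ih =>
        refine le_trans ?_ (hlow k)
        rw [pow_succ', mul_assoc]
        gcongr
    calc q ^ n₀ * q ^ L * ‖ψ‖ ≤ q ^ n₀ * q ^ m * ‖ψ‖ := by
          gcongr ?_ * ?_ * _
          exact pow_le_pow_of_le_one hq.le (hqρ.trans hρ1) (by omega)
      _ = q ^ n₀ * (q ^ m * ‖ψ‖) := by ring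
      _ ≤ _ := by gcongr; exact h1 m
  · change ‖T χ - lam • χ‖ ≤ r * ‖χ‖
    have h1 : ‖T χ - lam • χ‖ ≤ 3 * (ρ ^ n₀ * ‖(T ^ m) ψ‖) := by
      rw [htel]
      refine (norm_sub_le _ _).trans ?_
      rw [norm_smul, norm_pow, hlamn]
      have h2 : ρ ^ n * ‖(T ^ m) ψ‖ ≤ ρ ^ n₀ * ‖(T ^ m) ψ‖ := by
        gcongr ?_ * _
        exact pow_le_pow_of_le_one hρ0.le hρ1 (by omega)
      linarith
    refine h1.trans ((sq_le_sq₀ (by positivity) (by positivity)).mp ?_)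
    calc (3 * (ρ ^ n₀ * ‖(T ^ m) ψ‖)) ^ 2 = 9 * (ρ ^ n₀ * ‖(T ^ m) ψ‖) ^ 2 := by ring
      _ ≤ r ^ 2 * n * (ρ ^ n₀ * ‖(T ^ m) ψ‖) ^ 2 := by gcongr
      _ = r ^ 2 * (n * (ρ ^ n₀ * ‖(T ^ m) ψ‖) ^ 2) := by ring
      _ ≤ r ^ 2 * ‖χ‖ ^ 2 := by gcongr
      _ = _ := by ring

/-- Smooth spectral cutoffs of a self-adjoint operator above `-2ε` and below `-ε`. -/
theorem exists_spectral_cutoffs {H : Type*}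
    [NormedAddCommGroup H] [InnerProductSpace ℂ H] [CompleteSpace H]
    (R : H →L[ℂ] H) (hR : IsSelfAdjoint R) {ε : ℝ} (hε : 0 < ε) :
    ∃ F G : H →L[ℂ] H, IsSelfAdjoint F ∧ IsSelfAdjoint G ∧ F * F + G * G = 1 ∧
      (∀ φ, ‖φ - F φ‖ ^ 2 ≤ ‖G φ‖ ^ 2) ∧
      (∀ φ, -(2 * ε) * ‖F φ‖ ^ 2 ≤ (inner ℂ (R (F φ)) (F φ)).re) ∧
      (∀ φ, (inner ℂ (R (G φ)) (G φ)).re ≤ -ε * ‖G φ‖ ^ 2) ∧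
      ∀ X, Commute R X → Commute F X ∧ Commute G X := by
  set f : ℝ → ℝ := fun x => max 0 (min 1 ((x + 2 * ε) / ε)) with hf
  set g : ℝ → ℝ := fun x => Real.sqrt (1 - f x ^ 2) with hg
  have hfc : Continuous f := by fun_prop
  have hgc : Continuous g := by fun_prop
  have hf0 : ∀ x, 0 ≤ f x := fun x => le_max_left _ _
  have hf1 : ∀ x, f x ≤ 1 := fun x => max_le zero_le_one (min_le_left _ _)
  have hgg : ∀ x, g x * g x = 1 - f x ^ 2 := fun x =>
    Real.mul_self_sqrt (by nlinarith [hf0 x, hf1 x])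
  have hfl : ∀ x, x ≤ -(2 * ε) → f x = 0 := fun x hx =>
    max_eq_left ((min_le_right _ _).trans (div_nonpos_of_nonpos_of_nonneg (by linarith) hε.le))
  have hfr : ∀ x, -ε ≤ x → f x = 1 := fun x hx => by
    have : 1 ≤ (x + 2 * ε) / ε := by rw [le_div_iff₀ hε]; linarith
    simp [hf, min_eq_left this]
  have hg0 : ∀ x, 0 ≤ g x := fun x => Real.sqrt_nonneg _
  have hgr : ∀ x, -ε ≤ x → g x = 0 := fun x hx => by simp [hg, hfr x hx]
  clear_value g
  clear_value f
  have hfco : ContinuousOn f (spectrum ℝ R) := hfc.continuousOn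
  have hgco : ContinuousOn g (spectrum ℝ R) := hgc.continuousOn
  have hpos : ∀ h : ℝ → ℝ, (∀ x, 0 ≤ h x) → ∀ φ, 0 ≤ (inner ℂ (cfc h R φ) φ).re := by
    intro h hh φ
    have : (0 : H →L[ℂ] H) ≤ cfc h R := cfc_nonneg fun x _ => hh x
    exact ((nonneg_iff_isPositive _).mp this).re_inner_nonneg_left φ
  have hFsa : IsSelfAdjoint (cfc f R) := cfc_predicate f R
  have hGsa : IsSelfAdjoint (cfc g R) := cfc_predicate g R
  have hsymm : ∀ {X : H →L[ℂ] H}, IsSelfAdjoint X → ∀ x y, inner ℂ (X x) y = inner ℂ x (X y) :=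
    fun hX x y => (isSelfAdjoint_iff_isSymmetric.mp hX) x y
  have hnorm : ∀ x : H, (inner ℂ x x).re = ‖x‖ ^ 2 := fun x =>
    (norm_sq_eq_re_inner (𝕜 := ℂ) x).symm
  have hmul : ∀ (X Y : H →L[ℂ] H) (x : H), (X * Y) x = X (Y x) := fun _ _ _ => rfl
  have hone : ∀ x : H, (1 : H →L[ℂ] H) x = x := fun _ => rfl
  have hid : cfc (fun x : ℝ => x) R = R := cfc_id' ℝ R
  refine ⟨cfc f R, cfc g R, hFsa, hGsa, ?_, fun φ => ?_, fun φ => ?_, fun φ => ?_,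
    fun X hX => ⟨hX.cfc_real f, hX.cfc_real g⟩⟩
  · rw [← cfc_mul f f R, ← cfc_mul g g R, ← cfc_add .., ← cfc_one ℝ R]
    refine cfc_congr fun x _ => ?_
    simp only [hgg, Pi.one_apply]
    ring
  · have h1 := hpos (fun x => g x * g x - (1 - f x) * (1 - f x)) (fun x => by
      rw [hgg]; nlinarith [hf0 x, hf1 x]) φ
    have h2 : IsSelfAdjoint (1 - cfc f R) := (IsSelfAdjoint.one _).sub hFsa
    rw [cfc_sub .., cfc_mul g g R, cfc_mul .., cfc_sub .., cfc_const_one ℝ R] at h1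
    have h3 : (inner ℂ ((cfc g R * cfc g R - (1 - cfc f R) * (1 - cfc f R)) φ) φ).re
        = ‖cfc g R φ‖ ^ 2 - ‖φ - cfc f R φ‖ ^ 2 := by
      rw [sub_apply, inner_sub_left, Complex.sub_re, hmul, hmul, hsymm hGsa,
        hsymm h2, hnorm, hnorm]
      rfl
    linarith
  · have h1 := hpos (fun x => f x * ((x + 2 * ε) * f x)) (fun x => by
      rcases le_total x (-(2 * ε)) with h | h
      · simp [hfl x h]
      · have := hf0 x
        have : 0 ≤ x + 2 * ε := by linarith
        positivity) φ
    rw [cfc_mul .., cfc_mul .., cfc_add .., hid, cfc_const .., hmul, hsymm hFsa] at h1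
    simp only [hmul, add_apply, inner_add_left, Complex.add_re] at h1
    have h2 : (inner ℂ ((algebraMap ℝ (H →L[ℂ] H)) (2 * ε) (cfc f R φ)) (cfc f R φ)).re
        = 2 * ε * ‖cfc f R φ‖ ^ 2 := by
      rw [← hnorm, Algebra.algebraMap_eq_smul_one, smul_apply, hone, ← Complex.coe_smul,
        inner_smul_left]
      simp
    linarith
  · have h1 := hpos (fun x => g x * ((-x + -ε) * g x)) (fun x => by
      rcases le_total (-ε) x with h | h
      · simp [hgr x h]
      · have := hg0 x
        have : 0 ≤ -x + -ε := by linarith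
        positivity) φ
    rw [cfc_mul .., cfc_mul .., cfc_add .., cfc_neg, hid, cfc_const .., hmul, hsymm hGsa] at h1
    simp only [hmul, add_apply, neg_apply, inner_neg_left, Complex.neg_re, inner_add_left,
      Complex.add_re] at h1
    have h2 : (inner ℂ ((algebraMap ℝ (H →L[ℂ] H)) (-ε) (cfc g R φ)) (cfc g R φ)).re
        = -ε * ‖cfc g R φ‖ ^ 2 := by
      rw [← hnorm, Algebra.algebraMap_eq_smul_one, smul_apply, hone, ← Complex.coe_smul,
        inner_smul_left]
      simp
    linarith

/-- Telescoping identity for the Gramian of the shifted Cayley transform `T = 1 - 2 a u⁻¹`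
of `S`, where `u = S + 4 a`. -/
theorem cayley_gramian_lyapunov {H U : Type*}
    [NormedAddCommGroup H] [InnerProductSpace ℂ H]
    [NormedAddCommGroup U] [InnerProductSpace ℂ U]
    (S : H →L[ℂ] H) (Γ : H →L[ℂ] U) (a : ℝ) (u : (H →L[ℂ] H)ˣ)
    (hu : (u : H →L[ℂ] H) = S + (4 * a : ℂ) • 1) (T : H →L[ℂ] H)
    (hT : T = 1 - (2 * a : ℂ) • (↑u⁻¹ : H →L[ℂ] H)) (N : ℕ) (φ : H) :
    4 * a * ∑ k ∈ Finset.range N,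
        (inner ℂ (Γ ((↑u⁻¹ * T ^ k : H →L[ℂ] H) φ)) (Γ ((↑u⁻¹ * T ^ k : H →L[ℂ] H) (S φ)))).re
      + 12 * a ^ 2 * ∑ k ∈ Finset.range N, ‖Γ ((↑u⁻¹ * T ^ k : H →L[ℂ] H) φ)‖ ^ 2
      ≤ ‖Γ φ‖ ^ 2 := by
  have hTu : Commute T u := by
    rw [hT]
    exact (Commute.one_left _).sub_left
      ((Commute.units_inv_left (Commute.refl (u : H →L[ℂ] H))).smul_left _)
  have hexp : ∀ x y : U, ‖y + (4 * a : ℂ) • x‖ ^ 2 - ‖y + (2 * a : ℂ) • x‖ ^ 2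
      = 4 * a * (inner ℂ x y).re + 12 * a ^ 2 * ‖x‖ ^ 2 := by
    intro x y
    have h1 : ∀ b : ℝ, ‖y + (b : ℂ) • x‖ ^ 2
        = ‖y‖ ^ 2 + 2 * (b * (inner ℂ x y).re) + b ^ 2 * ‖x‖ ^ 2 := by
      intro b
      rw [@norm_add_sq ℂ, norm_smul, mul_pow, inner_smul_right, Complex.norm_real]
      have h2 : RCLike.re (inner ℂ y x) = (inner ℂ x y).re := inner_re_symm (𝕜 := ℂ) _ _
      have h3 : RCLike.re ((b : ℂ) * inner ℂ y x) = b * RCLike.re (inner ℂ y x) := by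
        simp
      rw [h3, h2]
      simp
    have h4 := h1 (4 * a)
    have h5 := h1 (2 * a)
    push_cast at h4 h5
    rw [h4, h5]
    ring
  have hstep : ∀ k, 4 * a *
        (inner ℂ (Γ ((↑u⁻¹ * T ^ k : H →L[ℂ] H) φ)) (Γ ((↑u⁻¹ * T ^ k : H →L[ℂ] H) (S φ)))).re
      + 12 * a ^ 2 * ‖Γ ((↑u⁻¹ * T ^ k : H →L[ℂ] H) φ)‖ ^ 2
      = ‖Γ ((T ^ k) φ)‖ ^ 2 - ‖Γ ((T ^ (k + 1)) φ)‖ ^ 2 := by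
    intro k
    set D := (↑u⁻¹ * T ^ k : H →L[ℂ] H) with hD
    have h1 : D * u = T ^ k := by
      rw [hD, mul_assoc, (hTu.pow_left k).eq, ← mul_assoc, Units.inv_mul, one_mul]
    have h2 : T ^ (k + 1) = T ^ k - (2 * a : ℂ) • D := by
      calc T ^ (k + 1) = T * T ^ k := pow_succ' _ _
        _ = (1 - (2 * a : ℂ) • (↑u⁻¹ : H →L[ℂ] H)) * T ^ k := by rw [← hT]
        _ = T ^ k - (2 * a : ℂ) • D := by rw [sub_mul, one_mul, smul_mul_assoc]
    have h3 : Γ ((T ^ k) φ) = Γ (D (S φ)) + (4 * a : ℂ) • Γ (D φ) := by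
      rw [← h1, hu, mul_add, mul_smul_comm, mul_one]
      simp only [add_apply, smul_apply, map_add, map_smul]
      rfl
    have h4 : Γ ((T ^ (k + 1)) φ) = Γ (D (S φ)) + (2 * a : ℂ) • Γ (D φ) := by
      rw [h2, sub_apply, map_sub, h3, smul_apply, map_smul]
      module
    rw [h3, h4, hexp]
  rw [Finset.mul_sum, Finset.mul_sum, ← Finset.sum_add_distrib,
    Finset.sum_congr rfl fun k _ => hstep k,
    Finset.sum_range_sub' (fun k => ‖Γ ((T ^ k) φ)‖ ^ 2)]
  simp

/-- A frequency-domain estimate on approximate eigenvectors in the range of `F` gives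
observability on that range. -/
theorem cayley_gramian_observability {H U : Type*}
    [NormedAddCommGroup H] [InnerProductSpace ℂ H] [CompleteSpace H]
    [NormedAddCommGroup U] [InnerProductSpace ℂ U]
    (S : H →L[ℂ] H) (hS : Commute S (adjoint S)) (Γ : H →L[ℂ] U) {a : ℝ} (ha : 0 < a)
    (hSa : ‖S‖ ≤ a / 2) (u : (H →L[ℂ] H)ˣ)
    (hu : (u : H →L[ℂ] H) = S + (4 * a : ℂ) • 1) (T : H →L[ℂ] H)
    (hT : T = 1 - (2 * a : ℂ) • (↑u⁻¹ : H →L[ℂ] H))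
    (F : H →L[ℂ] H) (hF : Commute F S) {r κ : ℝ} (hr : 0 < r) (hκ : 0 < κ)
    (hloc : ∀ (μ : ℂ) (φ : H), ‖μ • F φ - S (F φ)‖ ≤ r * ‖F φ‖ →
      ‖F φ‖ ^ 2 ≤ κ * ‖Γ (F φ)‖ ^ 2) :
    ∃ (N : ℕ) (δ : ℝ), 0 < δ ∧ ∀ φ, δ * ‖F φ‖ ^ 2 ≤
      ∑ k ∈ Finset.range N, ‖Γ ((↑u⁻¹ * T ^ k : H →L[ℂ] H) (F φ))‖ ^ 2 := by
  set D : H →L[ℂ] H := ↑u⁻¹ with hD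
  have hux : ∀ y, (u : H →L[ℂ] H) y = S y + (4 * a : ℂ) • y := fun y => by rw [hu]; rfl
  have huD : ∀ x, S (D x) + (4 * a : ℂ) • D x = x := fun x => by
    rw [← hux]
    exact DFunLike.congr_fun u.mul_inv x
  have hTx : ∀ x, T x = S (D x) + (2 * a : ℂ) • D x := fun x => by
    have : T x = x - (2 * a : ℂ) • D x := by rw [hT]; rfl
    rw [this]
    nth_rw 1 [← huD x]
    module
  have hSn : ∀ y, ‖S y‖ ≤ a / 2 * ‖y‖ := fun y => (S.le_opNorm y).trans (by gcongr)
  have hsm : ∀ (b : ℝ) (y : H), 0 ≤ b → ‖((b * a : ℝ) : ℂ) • y‖ = b * a * ‖y‖ := fun b y hb => by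
    rw [norm_smul, Complex.norm_real, Real.norm_of_nonneg (by positivity)]
  have hbd : ∀ (b : ℝ) (y : H), 0 ≤ b → (b - 1 / 2) * a * ‖y‖ ≤ ‖S y + ((b * a : ℝ) : ℂ) • y‖ ∧
      ‖S y + ((b * a : ℝ) : ℂ) • y‖ ≤ (b + 1 / 2) * a * ‖y‖ := by
    intro b y hb
    have h1 := norm_add_le (S y) (((b * a : ℝ) : ℂ) • y)
    have h2 := norm_sub_norm_le (((b * a : ℝ) : ℂ) • y) (-S y)
    rw [norm_neg, sub_neg_eq_add, add_comm _ (S y)] at h2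
    rw [hsm b y hb] at h1 h2
    constructor <;> nlinarith [hSn y]
  have hx : ∀ x, 7 / 2 * a * ‖D x‖ ≤ ‖x‖ ∧ ‖x‖ ≤ 9 / 2 * a * ‖D x‖ := fun x => by
    have := hbd 4 (D x) (by norm_num)
    push_cast at this
    rw [huD] at this
    constructor <;> linarith
  have hTb : ∀ x, 3 / 2 * a * ‖D x‖ ≤ ‖T x‖ ∧ ‖T x‖ ≤ 5 / 2 * a * ‖D x‖ := fun x => by
    have := hbd 2 (D x) (by norm_num)
    push_cast at this
    rw [← hTx] at this
    constructor <;> linarith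
  have hTn : Commute T (adjoint T) := by
    have h1 : Commute (u : H →L[ℂ] H) (star (u : H →L[ℂ] H)) := by
      rw [hu, star_add, star_smul, star_one]
      have h2 : Commute S (star S) := hS
      exact (h2.add_right ((Commute.one_right _).smul_right _)).add_left
        ((Commute.one_left _).smul_left _)
    have h2 : Commute D (star D) := by
      have h3 : Commute D (star (u : H →L[ℂ] H)) := h1.units_inv_left
      rw [← Units.coe_star] at h3
      have h4 := h3.units_inv_right
      rwa [← star_inv, Units.coe_star] at h4
    change Commute T (star T)
    rw [hT, star_sub, star_smul, star_one]
    exact (Commute.one_left _).sub_left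
      (((Commute.one_right D).sub_right (h2.smul_right _)).smul_left _)
  have hFD : Commute F D := by
    have : Commute F (u : H →L[ℂ] H) := by
      rw [hu]; exact hF.add_right ((Commute.one_right _).smul_right _)
    exact this.units_inv_right
  have hFT : Commute F T := by
    rw [hT]; exact (Commute.one_right _).sub_right (hFD.smul_right _)
  obtain ⟨L, n, δ₀, hδ₀, hap⟩ := exists_approx_eigenvector T hTn (q := 1 / 3) (s := 5 / 7)
    (by norm_num) (by norm_num) (by norm_num) (fun x => by linarith [hx x, hTb x])
    (fun x => by linarith [hx x, hTb x]) (r := r / (16 * a)) (by positivity)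
  refine ⟨L + n, δ₀ ^ 2 / ((9 / 2 * a) ^ 2 * κ * (n + 1)), by positivity, fun φ => ?_⟩
  obtain ⟨m, hm, lam, c, hlam, hc, hχl, hχe⟩ := hap (F φ)
  set χ := ∑ k ∈ Finset.range n, c k • (T ^ (m + k)) (F φ) with hχ
  have hDχF : D χ = F (D (∑ k ∈ Finset.range n, c k • (T ^ (m + k)) φ)) := by
    have h1 : χ = F (∑ k ∈ Finset.range n, c k • (T ^ (m + k)) φ) := by
      rw [hχ, map_sum]
      refine Finset.sum_congr rfl fun k _ => ?_
      rw [map_smul]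
      congr 1
      exact (DFunLike.congr_fun (hFT.pow_right (m + k)).eq φ).symm
    rw [h1]
    exact (DFunLike.congr_fun hFD.eq _).symm
  have hlam1 : 2 / 7 ≤ ‖1 - lam‖ := by
    have := norm_sub_norm_le (1 : ℂ) lam
    rw [norm_one] at this
    linarith
  have hlam0 : 1 - lam ≠ 0 := norm_pos_iff.mp (by linarith)
  have hobs : ‖D χ‖ ^ 2 ≤ κ * ‖Γ (D χ)‖ ^ 2 := by
    set μ := (4 * a * lam - 2 * a) / (1 - lam) with hμ
    have h1 : T χ - lam • χ = -((1 - lam) • (μ • D χ - S (D χ))) := by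
      have h2 : (1 - lam) * μ = 4 * a * lam - 2 * a := by rw [hμ]; field_simp
      rw [hTx]
      nth_rw 3 [← huD χ]
      rw [smul_sub, smul_smul, h2]
      module
    have h3 : ‖μ • D χ - S (D χ)‖ ≤ r * ‖D χ‖ := by
      rw [h1, norm_neg, norm_smul] at hχe
      have h4 : 2 / 7 * ‖μ • D χ - S (D χ)‖ ≤ r / (16 * a) * (9 / 2 * a * ‖D χ‖) :=
        (mul_le_mul_of_nonneg_right hlam1 (norm_nonneg _)).trans
          (hχe.trans (by gcongr; exact (hx χ).2))
      have h5 : r / (16 * a) * (9 / 2 * a * ‖D χ‖) = 9 / 32 * (r * ‖D χ‖) := by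
        field_simp; ring
      have h6 : 0 ≤ r * ‖D χ‖ := by positivity
      linarith
    rw [hDχF] at h3 ⊢
    exact hloc μ _ h3
  have hΓ : ‖Γ (D χ)‖ ≤ ∑ k ∈ Finset.range n, ‖Γ ((D * T ^ (m + k)) (F φ))‖ := by
    rw [hχ, map_sum, map_sum]
    refine norm_sum_le_of_le _ fun k _ => ?_
    rw [map_smul, map_smul, norm_smul]
    exact mul_le_of_le_one_left (norm_nonneg _) (hc k)
  have hsum : ∑ k ∈ Finset.range n, ‖Γ ((D * T ^ (m + k)) (F φ))‖ ^ 2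
      ≤ ∑ k ∈ Finset.range (L + n), ‖Γ ((D * T ^ k) (F φ))‖ ^ 2 := by
    have h1 := Finset.sum_Ico_eq_sum_range (fun k => ‖Γ ((D * T ^ k) (F φ))‖ ^ 2) m (m + n)
    rw [Nat.add_sub_cancel_left] at h1
    rw [← h1]
    refine Finset.sum_le_sum_of_subset_of_nonneg (fun k hk => ?_) fun _ _ _ => by positivity
    rw [Finset.mem_Ico] at hk
    rw [Finset.mem_range]
    omega
  have hcs : (∑ k ∈ Finset.range n, ‖Γ ((D * T ^ (m + k)) (F φ))‖) ^ 2
      ≤ n * ∑ k ∈ Finset.range n, ‖Γ ((D * T ^ (m + k)) (F φ))‖ ^ 2 := by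
    simpa using sq_sum_le_card_mul_sum_sq (s := Finset.range n)
      (f := fun k => ‖Γ ((D * T ^ (m + k)) (F φ))‖)
  rw [div_mul_eq_mul_div, div_le_iff₀ (by positivity)]
  set Q₀ := ∑ k ∈ Finset.range (L + n), ‖Γ ((D * T ^ k) (F φ))‖ ^ 2
  have hQ : 0 ≤ Q₀ := Finset.sum_nonneg fun _ _ => by positivity
  calc δ₀ ^ 2 * ‖F φ‖ ^ 2 = (δ₀ * ‖F φ‖) ^ 2 := by ring
    _ ≤ (9 / 2 * a * ‖D χ‖) ^ 2 :=
      pow_le_pow_left₀ (by positivity) (hχl.trans (hx χ).2) 2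
    _ = (9 / 2 * a) ^ 2 * ‖D χ‖ ^ 2 := by ring
    _ ≤ (9 / 2 * a) ^ 2 * (κ * (n * Q₀)) := by
      gcongr
      refine hobs.trans ?_
      gcongr
      calc ‖Γ (D χ)‖ ^ 2 ≤ _ := by gcongr
        _ ≤ _ := hcs
        _ ≤ _ := by gcongr
    _ ≤ (9 / 2 * a) ^ 2 * (κ * ((n + 1) * Q₀)) := by gcongr; linarith
    _ = _ := by ring

/-- On vectors where `S` has numerical range to the right of `-2ε`, the Hautus estimate bounds
approximate eigenvectors by their observation, with no restriction on the eigenvalue. -/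
theorem norm_sq_le_of_hautus_estimate {H U : Type*}
    [NormedAddCommGroup H] [InnerProductSpace ℂ H]
    [NormedAddCommGroup U] [InnerProductSpace ℂ U]
    (S : H →L[ℂ] H) (Γ : H →L[ℂ] U) {β C ε : ℝ} (hC : 0 < C) (hε : 0 < ε) (hεβ : 4 * ε ≤ β)
    (hest : ∀ lam : ℂ, -β < lam.re → ∀ φ : H, ‖φ‖ ^ 2 ≤ C / (lam.re + β) ^ 2 *
        (‖lam • φ - S φ‖ ^ 2 + ‖Γ φ‖ ^ 2))
    {x : H} (h1 : -(2 * ε) * ‖x‖ ^ 2 ≤ (inner ℂ (S x) x).re) (μ : ℂ)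
    (h : ‖μ • x - S x‖ ≤ ε / (2 * (1 + C)) * ‖x‖) :
    ‖x‖ ^ 2 ≤ 2 * C / ε ^ 2 * ‖Γ x‖ ^ 2 := by
  have hr0 : 0 < ε / (2 * (1 + C)) := by positivity
  have hr1 : ε / (2 * (1 + C)) ≤ ε / 2 := by gcongr; linarith
  set r := ε / (2 * (1 + C)) with hr
  have hx0 := norm_nonneg x
  rcases lt_or_ge μ.re (-3 * ε) with hμ | hμ
  · have h2 : (inner ℂ (μ • x - S x) x).re = μ.re * ‖x‖ ^ 2 - (inner ℂ (S x) x).re := by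
      rw [inner_sub_left, inner_smul_left, inner_self_eq_norm_sq_to_K, Complex.sub_re]
      congr 1
      change ((starRingEnd ℂ) μ * (‖x‖ : ℂ) ^ 2).re = μ.re * ‖x‖ ^ 2
      rw [← Complex.ofReal_pow, Complex.re_mul_ofReal, Complex.conj_re]
    have h3 : -(‖μ • x - S x‖ * ‖x‖) ≤ (inner ℂ (μ • x - S x) x).re :=
      (abs_le.mp ((Complex.abs_re_le_norm _).trans (norm_inner_le_norm _ _))).1
    have h4 : ε * ‖x‖ ^ 2 ≤ ε / 2 * ‖x‖ ^ 2 := by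
      nlinarith [mul_le_mul_of_nonneg_right (h.trans (mul_le_mul_of_nonneg_right hr1 hx0)) hx0,
        sq_nonneg ‖x‖]
    have h5 : ‖x‖ ^ 2 ≤ 0 := by nlinarith [sq_nonneg ‖x‖]
    exact h5.trans (by positivity)
  · have h1 := hest μ (by linarith) x
    have h2 : C / (μ.re + β) ^ 2 ≤ C / ε ^ 2 := by gcongr; linarith
    have h3 : ‖μ • x - S x‖ ^ 2 ≤ r ^ 2 * ‖x‖ ^ 2 := by
      rw [← mul_pow]
      exact pow_le_pow_left₀ (norm_nonneg _) h 2
    have h4 : C / ε ^ 2 * r ^ 2 ≤ 1 / 2 := by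
      have : C / ε ^ 2 * r ^ 2 = C / (4 * (1 + C) ^ 2) := by rw [hr]; field_simp; ring
      rw [this, div_le_div_iff₀ (by positivity) two_pos]
      nlinarith
    have h5 : ‖x‖ ^ 2 ≤ C / ε ^ 2 * (r ^ 2 * ‖x‖ ^ 2 + ‖Γ x‖ ^ 2) := by
      refine h1.trans ?_
      gcongr
    have h6 : C / ε ^ 2 * (r ^ 2 * ‖x‖ ^ 2) ≤ 1 / 2 * ‖x‖ ^ 2 := by
      rw [← mul_assoc]; gcongr
    have h7 : 2 * C / ε ^ 2 * ‖Γ x‖ ^ 2 = 2 * (C / ε ^ 2 * ‖Γ x‖ ^ 2) := by ring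
    rw [h7]
    linarith

/-- The self-adjoint operator with quadratic form `∑ ‖E k (F x)‖² + k₀ ‖G x‖²`. -/
theorem exists_isSelfAdjoint_weighted_gramian {H U : Type*}
    [NormedAddCommGroup H] [InnerProductSpace ℂ H] [CompleteSpace H]
    [NormedAddCommGroup U] [InnerProductSpace ℂ U] [CompleteSpace U]
    {F G : H →L[ℂ] H} (hF : IsSelfAdjoint F) (hG : IsSelfAdjoint G) (E : ℕ → H →L[ℂ] U)
    (N : ℕ) (k₀ : ℝ) :
    ∃ W : H →L[ℂ] H, IsSelfAdjoint W ∧ ∀ x y, (inner ℂ (W x) y).re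
      = ∑ k ∈ Finset.range N, (inner ℂ (E k (F x)) (E k (F y))).re
        + k₀ * (inner ℂ (G x) (G y)).re := by
  set P : H →L[ℂ] H := ∑ k ∈ Finset.range N, adjoint (E k) ∘L E k with hP
  have hPsa : IsSelfAdjoint P := by
    refine isSelfAdjoint_sum _ fun k _ => ?_
    rw [isSelfAdjoint_iff', adjoint_comp, adjoint_adjoint]
  have hPi : ∀ x y, inner ℂ (P x) y = ∑ k ∈ Finset.range N, inner ℂ (E k x) (E k y) := by
    intro x y
    rw [hP, sum_apply, sum_inner]
    exact Finset.sum_congr rfl fun k _ => adjoint_inner_left (E k) y (E k x)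
  have hsymm : ∀ {X : H →L[ℂ] H}, IsSelfAdjoint X → ∀ x y, inner ℂ (X x) y = inner ℂ x (X y) :=
    fun hX x y => (isSelfAdjoint_iff_isSymmetric.mp hX) x y
  refine ⟨F * P * F + k₀ • (G * G), ?_, fun x y => ?_⟩
  · refine IsSelfAdjoint.add ?_ ((IsSelfAdjoint.all k₀).smul ?_)
    · have := hPsa.conjugate F
      rwa [hF.star_eq] at this
    · have := IsSelfAdjoint.mul_star_self G
      rwa [hG.star_eq] at this
  · have h1 : (F * P * F + k₀ • (G * G)) x = F (P (F x)) + (k₀ : ℂ) • G (G x) := by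
      rw [Complex.coe_smul]; rfl
    rw [h1, inner_add_left, inner_smul_left, hsymm hF, hsymm hG, hPi, Complex.conj_ofReal,
      Complex.add_re, Complex.re_sum, Complex.re_ofReal_mul]

/-- The real part of a normal operator is self-adjoint and commutes with it. -/
theorem exists_isSelfAdjoint_re_inner_eq {H : Type*}
    [NormedAddCommGroup H] [InnerProductSpace ℂ H] [CompleteSpace H]
    (S : H →L[ℂ] H) (hS : Commute S (adjoint S)) :
    ∃ R : H →L[ℂ] H, IsSelfAdjoint R ∧ Commute R S ∧
      ∀ x, (inner ℂ (R x) x).re = (inner ℂ (S x) x).re := by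
  refine ⟨(1 / 2 : ℝ) • (S + adjoint S),
    (IsSelfAdjoint.all (1 / 2 : ℝ)).smul (IsSelfAdjoint.add_star_self S),
    ((Commute.refl S).add_left hS.symm).smul_left _, fun x => ?_⟩
  have h1 : (inner ℂ (adjoint S x) x).re = (inner ℂ (S x) x).re := by
    rw [adjoint_inner_left]
    exact inner_re_symm (𝕜 := ℂ) _ _
  have h2 : ((1 / 2 : ℝ) • (S + adjoint S)) x = ((1 / 2 : ℝ) : ℂ) • (S x + adjoint S x) := by
    rw [Complex.coe_smul]; rfl
  rw [h2, inner_smul_left, inner_add_left, Complex.conj_ofReal, Complex.re_ofReal_mul,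
    Complex.add_re, h1]
  ring

theorem exists_isUnit_add_smul {H : Type*}
    [NormedAddCommGroup H] [InnerProductSpace ℂ H] [CompleteSpace H] (S : H →L[ℂ] H) :
    ∃ a : ℝ, 0 < a ∧ 1 ≤ a ∧ ‖S‖ ≤ a / 2 ∧
      IsUnit (S + (4 * a : ℂ) • (1 : H →L[ℂ] H)) := by
  have hS0 := norm_nonneg S
  obtain ⟨a, ha⟩ : ∃ a : ℝ, a = 2 * ‖S‖ + 1 := ⟨_, rfl⟩
  have ha0 : 0 < a := by rw [ha]; positivity
  refine ⟨a, ha0, by linarith, by linarith, ?_⟩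
  have h1 : (-(4 * a : ℂ)) ∈ resolventSet ℂ S := by
    refine spectrum.mem_resolventSet_of_norm_lt_mul ?_
    have h2 : ‖(-(4 * a : ℂ))‖ = 4 * a := by
      rw [norm_neg, norm_mul, Complex.norm_real, Real.norm_of_nonneg ha0.le]
      norm_num
    have h3 : ‖(1 : H →L[ℂ] H)‖ ≤ 1 := norm_id_le
    rw [h2]
    nlinarith [mul_le_mul_of_nonneg_left h3 hS0]
  have h4 := (spectrum.mem_resolventSet_iff.mp h1).neg
  rw [Algebra.algebraMap_eq_smul_one] at h4
  convert h4 using 1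
  module

/-- For normal `S`, the Hautus estimate yields a weighted observability Gramian that solves the
Lyapunov inequality modulo `‖Γ φ‖²`. -/
theorem exists_lyapunov_operator_of_hautus_estimate {H U : Type*}
    [NormedAddCommGroup H] [InnerProductSpace ℂ H] [CompleteSpace H]
    [NormedAddCommGroup U] [InnerProductSpace ℂ U] [CompleteSpace U]
    (S : H →L[ℂ] H) (Γ : H →L[ℂ] U) (hS : Commute S (adjoint S)) {β C : ℝ} (hβ : 0 < β)
    (hC : 0 < C)
    (hest : ∀ lam : ℂ, -β < lam.re → ∀ φ : H, ‖φ‖ ^ 2 ≤ C / (lam.re + β) ^ 2 *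
        (‖lam • φ - S φ‖ ^ 2 + ‖Γ φ‖ ^ 2)) :
    ∃ W : H →L[ℂ] H, IsSelfAdjoint W ∧ ∃ δ e c : ℝ, 0 < δ ∧ 0 < e ∧
      (∀ φ, δ * ‖φ‖ ^ 2 ≤ (inner ℂ (W φ) φ).re) ∧
      ∀ φ, (inner ℂ (W φ) (S φ)).re + e * (inner ℂ (W φ) φ).re ≤ c * ‖Γ φ‖ ^ 2 := by
  obtain ⟨ε, hε, hε1, hεβ⟩ : ∃ ε : ℝ, 0 < ε ∧ ε ≤ 1 ∧ 4 * ε ≤ β :=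
    ⟨min (β / 4) 1, lt_min (by positivity) one_pos, min_le_right _ _,
      by linarith [min_le_left (β / 4) 1]⟩
  obtain ⟨R, hRsa, hRS, hRre⟩ := exists_isSelfAdjoint_re_inner_eq S hS
  obtain ⟨F, G, hF, hG, hFG, hFle, hFre, hGre, hcomm⟩ := exists_spectral_cutoffs R hRsa hε
  obtain ⟨hFS, hGS⟩ := hcomm S hRS
  have hFS' : ∀ x, F (S x) = S (F x) := fun x => DFunLike.congr_fun hFS.eq x
  have hGS' : ∀ x, G (S x) = S (G x) := fun x => DFunLike.congr_fun hGS.eq x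
  obtain ⟨a, ha0, ha1, haS, u, hu⟩ := exists_isUnit_add_smul S
  obtain ⟨T, hT⟩ : ∃ T : H →L[ℂ] H, T = 1 - (2 * a : ℂ) • (↑u⁻¹ : H →L[ℂ] H) := ⟨_, rfl⟩
  have hloc : ∀ (μ : ℂ) (φ : H), ‖μ • F φ - S (F φ)‖ ≤ ε / (2 * (1 + C)) * ‖F φ‖ →
      ‖F φ‖ ^ 2 ≤ 2 * C / ε ^ 2 * ‖Γ (F φ)‖ ^ 2 := by
    intro μ φ
    have h1 := hFre φ
    rw [hRre] at h1
    exact norm_sq_le_of_hautus_estimate S Γ hC hε hεβ hest h1 μ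
  obtain ⟨N, δ, hδ, hobs⟩ := cayley_gramian_observability S hS Γ ha0 haS u hu T hT F
    hFS (r := ε / (2 * (1 + C))) (κ := 2 * C / ε ^ 2) (by positivity) (by positivity) hloc
  obtain ⟨k₀, hk₀⟩ : ∃ k₀ : ℝ, k₀ = ‖Γ‖ ^ 2 / (a * ε) + 1 := ⟨_, rfl⟩
  have hk₀0 : 0 < k₀ := by rw [hk₀]; positivity
  obtain ⟨E, hE⟩ : ∃ E : ℕ → H →L[ℂ] U,
      ∀ k x, E k x = Γ ((↑u⁻¹ * T ^ k : H →L[ℂ] H) x) :=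
    ⟨fun k => Γ ∘L (↑u⁻¹ * T ^ k), fun _ _ => rfl⟩
  have hlyap : ∀ φ, 4 * a * ∑ k ∈ Finset.range N, (inner ℂ (E k φ) (E k (S φ))).re
      + 12 * a ^ 2 * ∑ k ∈ Finset.range N, ‖E k φ‖ ^ 2 ≤ ‖Γ φ‖ ^ 2 := fun φ => by
    simp only [hE]
    exact cayley_gramian_lyapunov S Γ a u hu T hT N φ
  simp only [← hE] at hobs
  obtain ⟨W, hWsa, hWi⟩ := exists_isSelfAdjoint_weighted_gramian hF hG E N k₀
  have hsymm : ∀ {X : H →L[ℂ] H}, IsSelfAdjoint X → ∀ x y, inner ℂ (X x) y = inner ℂ x (X y) :=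
    fun hX x y => (isSelfAdjoint_iff_isSymmetric.mp hX) x y
  have hnorm : ∀ x : H, (inner ℂ x x).re = ‖x‖ ^ 2 :=
    fun x => (norm_sq_eq_re_inner (𝕜 := ℂ) x).symm
  have hnormU : ∀ x : U, (inner ℂ x x).re = ‖x‖ ^ 2 :=
    fun x => (norm_sq_eq_re_inner (𝕜 := ℂ) x).symm
  have hWq : ∀ x, (inner ℂ (W x) x).re
      = ∑ k ∈ Finset.range N, ‖E k (F x)‖ ^ 2 + k₀ * ‖G x‖ ^ 2 := by
    intro x
    rw [hWi, hnorm]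
    simp only [hnormU]
  have hpart : ∀ x, ‖x‖ ^ 2 = ‖F x‖ ^ 2 + ‖G x‖ ^ 2 := by
    intro x
    have h1 : x = F (F x) + G (G x) := (DFunLike.congr_fun hFG x).symm
    rw [← hnorm x]
    nth_rw 1 [h1]
    rw [inner_add_left, hsymm hF, hsymm hG, Complex.add_re, hnorm, hnorm]
  refine ⟨W, hWsa, min δ k₀, ε / 2, 1 / (2 * a), lt_min hδ hk₀0, by positivity, fun φ => ?_,
    fun φ => ?_⟩
  · rw [hWq, hpart, mul_add]
    have h1 : ∑ k ∈ Finset.range N, ‖E k (F φ)‖ ^ 2 ≥ δ * ‖F φ‖ ^ 2 := hobs φ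
    have h2 : min δ k₀ * ‖F φ‖ ^ 2 ≤ δ * ‖F φ‖ ^ 2 := by gcongr; exact min_le_left _ _
    have h3 : min δ k₀ * ‖G φ‖ ^ 2 ≤ k₀ * ‖G φ‖ ^ 2 := by gcongr; exact min_le_right _ _
    linarith
  · rw [hWq, hWi, hFS', hGS']
    have h1 := hlyap (F φ)
    have h2 : (inner ℂ (G φ) (S (G φ))).re ≤ -ε * ‖G φ‖ ^ 2 := by
      have h3 := hGre φ
      rw [hRre] at h3
      exact (inner_re_symm (𝕜 := ℂ) _ _).trans_le h3
    have h4 : ‖Γ (F φ)‖ ^ 2 ≤ 2 * ‖Γ φ‖ ^ 2 + 2 * ‖Γ‖ ^ 2 * ‖G φ‖ ^ 2 := by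
      have h5 : ‖Γ (F φ)‖ ≤ ‖Γ φ‖ + ‖Γ (φ - F φ)‖ := by
        have : Γ (F φ) = Γ φ - Γ (φ - F φ) := by rw [map_sub]; abel
        rw [this]
        exact norm_sub_le _ _
      have h6 : ‖Γ (φ - F φ)‖ ^ 2 ≤ ‖Γ‖ ^ 2 * ‖G φ‖ ^ 2 :=
        calc ‖Γ (φ - F φ)‖ ^ 2 ≤ (‖Γ‖ * ‖φ - F φ‖) ^ 2 :=
              pow_le_pow_left₀ (norm_nonneg _) (Γ.le_opNorm _) 2
          _ = ‖Γ‖ ^ 2 * ‖φ - F φ‖ ^ 2 := mul_pow _ _ _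
          _ ≤ _ := mul_le_mul_of_nonneg_left (hFle φ) (by positivity)
      nlinarith [pow_le_pow_left₀ (norm_nonneg _) h5 2, sq_nonneg (‖Γ φ‖ - ‖Γ (φ - F φ)‖)]
    set Q := ∑ k ∈ Finset.range N, ‖E k (F φ)‖ ^ 2
    set I := ∑ k ∈ Finset.range N, (inner ℂ (E k (F φ)) (E k (S (F φ)))).re
    have hQ : 0 ≤ Q := Finset.sum_nonneg fun _ _ => by positivity
    have h7 : ‖Γ‖ ^ 2 ≤ k₀ * (a * ε) := by
      rw [hk₀, add_mul, div_mul_cancel₀ _ (by positivity)]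
      have : 0 < a * ε := by positivity
      linarith
    have h8 : ‖Γ‖ ^ 2 * ‖G φ‖ ^ 2 ≤ k₀ * (a * ε) * ‖G φ‖ ^ 2 := by gcongr
    have h9 : k₀ * (inner ℂ (G φ) (S (G φ))).re ≤ k₀ * (-ε * ‖G φ‖ ^ 2) := by gcongr
    have h10 : 2 * a * (I + 3 * a * Q) ≤ ‖Γ φ‖ ^ 2 + k₀ * (a * ε) * ‖G φ‖ ^ 2 := by nlinarith
    have h11 : ε / 2 * Q ≤ 3 * a * Q := by gcongr; linarith
    rw [one_div_mul_eq_div, le_div_iff₀ (by positivity)]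
    have h12 : 2 * a * (I + k₀ * (inner ℂ (G φ) (S (G φ))).re + ε / 2 * (Q + k₀ * ‖G φ‖ ^ 2))
        ≤ 2 * a * (I + 3 * a * Q - k₀ * (ε / 2) * ‖G φ‖ ^ 2) := by gcongr; linarith
    linarith

end

/-- For `A` a bounded normal operator on a separable complex Hilbert space `H` and
`B : U →L H` bounded, the system `[A,B]` is exponentially stabilizable iff the pair
`(A*, B*)` satisfies the quantitative frequency-domain condition (HESI)_β for some `β > 0`. -/
theorem stabilizable_iff_HESI_of_normal
    {H U : Type*}
    [NormedAddCommGroup H] [InnerProductSpace ℂ H] [CompleteSpace H]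
    [TopologicalSpace.SeparableSpace H]
    [NormedAddCommGroup U] [InnerProductSpace ℂ U] [CompleteSpace U]
    [TopologicalSpace.SeparableSpace U]
    (A : H →L[ℂ] H) (B : U →L[ℂ] H)
    (hA : A ∘L ContinuousLinearMap.adjoint A = ContinuousLinearMap.adjoint A ∘L A) :
    (∃ K : H →L[ℂ] U, ∃ M : ℝ, 0 < M ∧ ∃ α : ℝ, 0 < α ∧
      ∀ t : ℝ, 0 ≤ t →
        ‖NormedSpace.exp (t • (A + B ∘L K))‖ ≤ M * Real.exp (-α * t)) ↔
    (∃ β : ℝ, 0 < β ∧ ∃ C : ℝ, 0 < C ∧ ∀ lam : ℂ, -β < lam.re → ∀ φ : H,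
      ‖φ‖ ^ 2 ≤ C / (lam.re + β) ^ 2 *
        (‖lam • φ - (ContinuousLinearMap.adjoint A) φ‖ ^ 2
          + ‖(ContinuousLinearMap.adjoint B) φ‖ ^ 2)) := by
  constructor
  · rintro ⟨K, M, hM, α, hα, hS⟩
    exact ⟨α, hα, 2 * M ^ 2 * (1 + ‖K‖ ^ 2), by positivity, fun lam hlam φ =>
      hautus_estimate_of_norm_exp_le A B K hS lam hlam φ⟩
  · rintro ⟨β, hβ, C, hC, hest⟩
    obtain ⟨W, hW, δ, e, c, hδ, he, hcoer, hlyap⟩ :=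
      exists_lyapunov_operator_of_hautus_estimate (ContinuousLinearMap.adjoint A)
        (ContinuousLinearMap.adjoint B)
        (by rw [ContinuousLinearMap.adjoint_adjoint]; exact hA.symm) hβ hC hest
    exact exists_feedback_of_lyapunov A B W hW hδ he hcoer hlyap
end

section
/- Let H and U be separable complex Hilbert spaces, A : H → H a bounded normal operator (i.e. A∘A* = A*∘A) and B : U → H a bounded linear operator. Then the system [A,B] is rapidly stabilizable if and only if the pair (A*,B*) satisfies (HESI)_β for every β > 0. -/
open ContinuousLinearMap

/-- A bounded operator on a nontrivial complex Banach space has an approximate eigenvalue. -/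
theorem spectrum_exists_not_boundedBelow {E : Type*} [NormedAddCommGroup E] [NormedSpace ℂ E]
    [CompleteSpace E] [Nontrivial E] (T : E →L[ℂ] E) :
    ¬ ∀ ν : ℂ, ∃ c : ℝ, 0 < c ∧ ∀ x, c * ‖x‖ ≤ ‖ν • x - T x‖ := by
  intro h
  have hclosed : IsClosed (resolventSet ℂ T) := by
    refine isClosed_of_closure_subset fun ν hν ↦ ?_
    obtain ⟨c, hc, hb⟩ := h ν
    obtain ⟨w, hw, hd⟩ := Metric.mem_closure_iff.1 hν (c / 2) (half_pos hc)
    obtain ⟨u, hu⟩ : IsUnit (algebraMap ℂ (E →L[ℂ] E) w - T) := hw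
    have hu_apply (x : E) : (u : E →L[ℂ] E) x = w • x - T x := by
      rw [hu]; simp [Algebra.algebraMap_eq_smul_one]
    have hlow (x : E) : c / 2 * ‖x‖ ≤ ‖(u : E →L[ℂ] E) x‖ := by
      have h1 : ‖ν • x - T x‖ ≤ ‖w • x - T x‖ + ‖(ν - w) • x‖ := by
        refine le_trans (le_of_eq ?_) (norm_add_le _ _)
        rw [sub_smul]; congr 1; abel
      rw [norm_smul, ← dist_eq_norm ν w] at h1
      have h2 := mul_le_mul_of_nonneg_right hd.le (norm_nonneg x)
      rw [hu_apply]
      linarith [hb x]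
    have hinv : ‖((u⁻¹ : (E →L[ℂ] E)ˣ) : E →L[ℂ] E)‖ ≤ (c / 2)⁻¹ := by
      refine ContinuousLinearMap.opNorm_le_bound _ (by positivity) fun x ↦ ?_
      have h1 := hlow (((u⁻¹ : (E →L[ℂ] E)ˣ) : E →L[ℂ] E) x)
      rw [← mul_apply_eq_comp, Units.mul_inv, one_apply_eq_self] at h1
      rw [inv_mul_eq_div, le_div_iff₀ (by positivity)]
      linarith
    have hpos : 0 < ‖((u⁻¹ : (E →L[ℂ] E)ˣ) : E →L[ℂ] E)‖ := Units.norm_pos _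
    have hlt : ‖(algebraMap ℂ (E →L[ℂ] E) ν - T) - u‖ <
        ‖((u⁻¹ : (E →L[ℂ] E)ˣ) : E →L[ℂ] E)‖⁻¹ := by
      rw [hu, sub_sub_sub_cancel_right, ← map_sub, norm_algebraMap', ← dist_eq_norm]
      refine hd.trans_le ?_
      rw [le_inv_comm₀ (by positivity) hpos]
      exact hinv
    exact (u.ofNearby _ hlt).isUnit
  rcases isClopen_iff.1 ⟨hclosed, spectrum.isOpen_resolventSet T⟩ with h0 | h1
  · have : ((‖T‖ + 1 : ℝ) : ℂ) ∈ resolventSet ℂ T := by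
      apply spectrum.mem_resolventSet_of_norm_lt
      rw [Complex.norm_real, Real.norm_of_nonneg (by positivity)]
      linarith
    rw [h0] at this
    exact this
  · obtain ⟨ν, hν⟩ := spectrum.nonempty T
    exact hν (h1 ▸ Set.mem_univ ν)

/-- A left ideal `L` of a Banach algebra that is stable under right multiplication by `R`, and modulo
which every `ν - R` is left invertible, contains `1`. -/
theorem one_mem_of_leftIdeal {𝓐 : Type*} [NormedRing 𝓐] [NormedAlgebra ℂ 𝓐] [CompleteSpace 𝓐]
    (L : Ideal 𝓐) (R : 𝓐) (hR : ∀ T ∈ L, T * R ∈ L)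
    (h : ∀ ν : ℂ, ∃ X, X * (algebraMap ℂ 𝓐 ν - R) - 1 ∈ L) : 1 ∈ L := by
  by_contra h1
  have hcl : (1 : 𝓐) ∉ closure (L : Set 𝓐) := by
    intro hc
    have hopen : {x : 𝓐 | IsUnit x} ∈ nhds (1 : 𝓐) := Units.isOpen.mem_nhds isUnit_one
    obtain ⟨x, hx, hxL⟩ := mem_closure_iff_nhds.1 hc _ hopen
    exact h1 (L.eq_top_of_isUnit_mem hxL hx ▸ Submodule.mem_top)
  let L' : Submodule ℂ 𝓐 := L.restrictScalars ℂ
  have hnorm : ‖(L'.mkQ 1)‖ ≠ 0 := by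
    intro h0
    refine hcl ?_
    rw [Submodule.mkQ_apply] at h0
    exact (QuotientAddGroup.norm_mk_eq_zero_iff_mem_closure (S := L'.toAddSubgroup)).1 h0
  obtain ⟨g, -, hg⟩ := exists_dual_vector ℂ (L'.mkQ 1) hnorm
  let ρ : 𝓐 →L[ℂ] 𝓐 := (ContinuousLinearMap.mul ℂ 𝓐).flip R
  let Φ : StrongDual ℂ 𝓐 →L[ℂ] StrongDual ℂ 𝓐 := (ContinuousLinearMap.compL ℂ 𝓐 𝓐 ℂ).flip ρ
  let N : Submodule ℂ (StrongDual ℂ 𝓐) :=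
    { carrier := {f | ∀ T ∈ L, f T = 0}
      add_mem' := fun {f g} hf hg T hT ↦ by simp [hf T hT, hg T hT]
      zero_mem' := fun T _ ↦ rfl
      smul_mem' := fun c f hf T hT ↦ by simp [hf T hT] }
  have hN : IsClosed (N : Set (StrongDual ℂ 𝓐)) := by
    have : (N : Set (StrongDual ℂ 𝓐)) = ⋂ T ∈ L, {f | f T = 0} := by
      ext f; simp [N]
    rw [this]
    exact isClosed_biInter fun T _ ↦
      isClosed_eq (ContinuousLinearMap.apply ℂ ℂ T).continuous continuous_const
  have : CompleteSpace N := hN.completeSpace_coe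
  let f₀ : StrongDual ℂ 𝓐 := g.comp (L'.mkQL)
  have hf₀ : f₀ ∈ N := fun T hT ↦ by
    have : L'.mkQ T = 0 := (Submodule.Quotient.mk_eq_zero L').2 hT
    change g (L'.mkQ T) = 0
    rw [this, map_zero]
  have : Nontrivial N := by
    refine ⟨⟨f₀, hf₀⟩, 0, fun h0 ↦ hnorm ?_⟩
    have h2 : f₀ 1 = 0 := by
      have h4 : f₀ = 0 := Subtype.ext_iff.1 h0
      rw [h4, zero_apply]
    have h3 : f₀ 1 = ‖L'.mkQ 1‖ := hg
    exact_mod_cast h3.symm.trans h2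
  let T : N →L[ℂ] N := Φ.restrict (p := N) (q := N) fun f hf S hS ↦ hf _ (hR S hS)
  refine spectrum_exists_not_boundedBelow (E := N) T fun ν ↦ ?_
  obtain ⟨X, hX⟩ := h ν
  refine ⟨(‖X‖ + 1)⁻¹, by positivity, fun f ↦ ?_⟩
  rw [inv_mul_le_iff₀ (by positivity)]
  have hfapp (S : 𝓐) : (f : StrongDual ℂ 𝓐) S = ((ν • f - T f : N) : StrongDual ℂ 𝓐) (S * X) := by
    have h2 : (f : StrongDual ℂ 𝓐) (S * (X * (algebraMap ℂ 𝓐 ν - R) - 1)) = 0 :=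
      f.2 _ (L.mul_mem_left S hX)
    have h3 : S * (X * (algebraMap ℂ 𝓐 ν - R) - 1) = ν • (S * X) - S * X * R - S := by
      rw [Algebra.algebraMap_eq_smul_one]
      simp [mul_sub, mul_assoc]
    rw [h3, map_sub, map_sub, map_smul, sub_eq_zero] at h2
    exact h2.symm
  change ‖(f : StrongDual ℂ 𝓐)‖ ≤ (‖X‖ + 1) * ‖((ν • f - T f : N) : StrongDual ℂ 𝓐)‖
  refine ContinuousLinearMap.opNorm_le_bound _ (by positivity) fun S ↦ ?_
  rw [hfapp]
  calc _ ≤ ‖((ν • f - T f : N) : StrongDual ℂ 𝓐)‖ * (‖S‖ * ‖X‖) :=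
        (ContinuousLinearMap.le_opNorm _ _).trans (by gcongr; exact norm_mul_le _ _)
    _ ≤ _ := by
        nlinarith [mul_nonneg (norm_nonneg ((ν • f - T f : N) : StrongDual ℂ 𝓐)) (norm_nonneg S)]

/-- Exponential decay from a coercive quadratic Lyapunov function. -/
theorem norm_exp_le_of_lyapunov {H : Type*} [NormedAddCommGroup H] [InnerProductSpace ℂ H]
    [CompleteSpace H] (S Λ : H →L[ℂ] H) (hΛ : IsSelfAdjoint Λ) {δ α : ℝ} (hδ : 0 < δ)
    (hcoer : ∀ x, δ * ‖x‖ ^ 2 ≤ (inner ℂ (Λ x) x).re)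
    (hlyap : ∀ x, (inner ℂ (Λ x) (S x)).re ≤ -α * (inner ℂ (Λ x) x).re) {t : ℝ} (ht : 0 ≤ t) :
    ‖NormedSpace.exp (t • S)‖ ≤ √(‖Λ‖ / δ) * Real.exp (-α * t) := by
  refine opNorm_le_bound _ (by positivity) fun x ↦ ?_
  let y : ℝ → H := fun s ↦ NormedSpace.exp (s • S) x
  have hy (s : ℝ) : HasDerivAt y (S (y s)) s :=
    ((ContinuousLinearMap.apply ℂ H x).restrictScalars ℝ).hasFDerivAt.comp_hasDerivAt s
      (hasDerivAt_exp_smul_const' S s)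
  let V : ℝ → ℝ := fun s ↦ (inner ℂ (Λ (y s)) (y s)).re
  have hV (s : ℝ) : HasDerivAt V (2 * (inner ℂ (Λ (y s)) (S (y s))).re) s := by
    have h1 := ((Λ.restrictScalars ℝ).hasFDerivAt.comp_hasDerivAt s (hy s)).inner ℂ (hy s)
    have h2 := Complex.reCLM.hasFDerivAt.comp_hasDerivAt s h1
    refine h2.congr_deriv ?_
    have h3 : inner ℂ (Λ (S (y s))) (y s) = inner ℂ (S (y s)) (Λ (y s)) :=
      hΛ.isSymmetric _ _
    have h4 := inner_re_symm (𝕜 := ℂ) (S (y s)) (Λ (y s))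
    simp only [RCLike.re_to_complex] at h4
    simp [h3, h4]
    ring
  have hanti : Antitone fun s ↦ V s * Real.exp (2 * α * s) := by
    have hd (s : ℝ) := (hV s).mul (((hasDerivAt_id s).const_mul (2 * α)).exp)
    refine antitone_of_hasDerivAt_nonpos hd fun s ↦ ?_
    have := mul_le_mul_of_nonneg_right (hlyap (y s)) (Real.exp_pos (2 * α * s)).le
    simp only [V, id, Pi.zero_apply]
    nlinarith
  have h0 := hanti ht
  have hV0 : V 0 ≤ ‖Λ‖ * ‖x‖ ^ 2 := by
    have : y 0 = x := by simp [y]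
    simp only [V, this]
    calc _ ≤ ‖inner ℂ (Λ x) x‖ := Complex.re_le_norm _
      _ ≤ ‖Λ x‖ * ‖x‖ := norm_inner_le_norm _ _
      _ ≤ ‖Λ‖ * ‖x‖ * ‖x‖ := by gcongr; exact Λ.le_opNorm x
      _ = _ := by ring
  simp only [mul_zero, Real.exp_zero, mul_one] at h0
  change ‖y t‖ ≤ _
  refine le_of_sq_le_sq ?_ (by positivity)
  rw [mul_pow, mul_pow, Real.sq_sqrt (by positivity), ← Real.exp_nat_mul, div_mul_eq_mul_div,
    div_mul_eq_mul_div, le_div_iff₀ hδ]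
  have he : Real.exp (2 * α * t) * Real.exp ((2 : ℕ) * (-α * t)) = 1 := by
    rw [← Real.exp_add]; simp; ring
  have h5 := mul_le_mul_of_nonneg_right (h0.trans hV0) (Real.exp_pos ((2 : ℕ) * (-α * t))).le
  rw [mul_assoc, he] at h5
  have := hcoer (y t)
  simp only [V] at h5
  linarith

/-- The resolvent estimate for the generator of an exponentially bounded semigroup. -/
theorem norm_sub_ge_of_norm_exp_le {E : Type*} [NormedAddCommGroup E] [NormedSpace ℂ E]
    [CompleteSpace E] (S : E →L[ℂ] E) {M β : ℝ}
    (hS : ∀ t : ℝ, 0 ≤ t → ‖NormedSpace.exp (t • S)‖ ≤ M * Real.exp (-β * t))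
    {lam : ℂ} (hlam : -β < lam.re) (x : E) :
    (lam.re + β) * ‖x‖ ≤ M * ‖lam • x - S x‖ := by
  set r := lam.re + β with hr
  have hrpos : 0 < r := by linarith
  let f : ℝ → E := fun t ↦ x - Complex.exp (-lam * t) • NormedSpace.exp (t • S) x
  let f' : ℝ → E := fun t ↦ Complex.exp (-lam * t) • NormedSpace.exp (t • S) (lam • x - S x)
  have hf (t : ℝ) : HasDerivAt f (f' t) t := by
    have h1 : HasDerivAt (fun s : ℝ ↦ NormedSpace.exp (s • S) x)
        (NormedSpace.exp (t • S) (S x)) t :=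
      ((ContinuousLinearMap.apply ℂ E x).restrictScalars ℝ).hasFDerivAt.comp_hasDerivAt t
        (hasDerivAt_exp_smul_const S t)
    have h2 : HasDerivAt (fun s : ℝ ↦ Complex.exp (-lam * s))
        (Complex.exp (-lam * t) * (-lam * 1)) t :=
      ((Complex.ofRealCLM.hasDerivAt (x := t)).const_mul (-lam)).cexp
    refine ((h2.smul h1).const_sub x).congr_deriv ?_
    simp only [f', map_sub, map_smul, smul_sub, mul_one, mul_neg, neg_smul, smul_smul]
    abel
  have hexp (t : ℝ) : ‖Complex.exp (-lam * t)‖ = Real.exp (-lam.re * t) := by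
    rw [Complex.norm_exp]; simp
  have hbound (t : ℝ) (ht : 0 ≤ t) (z : E) :
      ‖Complex.exp (-lam * t) • NormedSpace.exp (t • S) z‖ ≤ M * ‖z‖ * Real.exp (-r * t) := by
    rw [norm_smul, hexp]
    calc _ ≤ Real.exp (-lam.re * t) * (M * Real.exp (-β * t) * ‖z‖) := by
          gcongr
          exact (ContinuousLinearMap.le_opNorm _ _).trans (by gcongr; exact hS t ht)
      _ = M * ‖z‖ * (Real.exp (-lam.re * t) * Real.exp (-β * t)) := by ring
      _ = _ := by rw [← Real.exp_add, hr]; ring_nf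
  set C := M * ‖lam • x - S x‖
  have hmain (t : ℝ) (ht : 0 ≤ t) : ‖f t‖ ≤ C / r - C / r * Real.exp (-r * t) := by
    refine image_norm_le_of_norm_deriv_right_le_deriv_boundary (a := 0) (b := t) (f := f) (f' := f')
      (B := fun s ↦ C / r - C / r * Real.exp (-r * s)) (B' := fun s ↦ C * Real.exp (-r * s))
      (fun s _ ↦ (hf s).continuousAt.continuousWithinAt) (fun s _ ↦ (hf s).hasDerivWithinAt)
      (by simp [f]) (fun s ↦ ?_) (fun s hs ↦ hbound s hs.1 _) ⟨ht, le_rfl⟩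
    have := ((((hasDerivAt_id s).const_mul (-r)).exp).const_mul (C / r)).const_sub (C / r)
    refine this.congr_deriv ?_
    simp only [id]
    field_simp
  have hx (t : ℝ) (ht : 0 ≤ t) :
      ‖x‖ ≤ (C / r - C / r * Real.exp (-r * t)) + M * ‖x‖ * Real.exp (-r * t) := by
    refine le_trans ?_ (add_le_add (hmain t ht) (hbound t ht x))
    refine le_trans (le_of_eq ?_) (norm_add_le _ _)
    simp [f]
  have hlim : Filter.Tendsto (fun t : ℝ ↦ Real.exp (-r * t)) Filter.atTop (nhds 0) :=
    Real.tendsto_exp_atBot.comp (Filter.tendsto_id.const_mul_atTop_of_neg (by linarith))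
  have hlim2 := ((hlim.const_mul (C / r)).const_sub (C / r)).add (hlim.const_mul (M * ‖x‖))
  have := ge_of_tendsto hlim2 (Filter.eventually_atTop.2 ⟨0, hx⟩)
  simp only [mul_zero, sub_zero, add_zero] at this
  rwa [le_div_iff₀ hrpos, mul_comm] at this

/-- The Stein equation `Λ = W (Q + Λ) W*` has a nonnegative solution when `‖W‖ < 1` and `0 ≤ Q`. -/
theorem exists_nonneg_stein {𝓐 : Type*} [CStarAlgebra 𝓐] [PartialOrder 𝓐] [StarOrderedRing 𝓐]
    {W Q : 𝓐} (hW : ‖W‖ < 1) (hQ : 0 ≤ Q) : ∃ Λ : 𝓐, 0 ≤ Λ ∧ Λ = W * (Q + Λ) * star W := by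
  let f : ℕ → 𝓐 := fun k ↦ W ^ k * Q * star (W ^ k)
  have hsummable : Summable f := by
    have hlt : ‖W‖ ^ 2 < 1 := by nlinarith [norm_nonneg W]
    refine .of_norm_bounded_eventually_nat (g := fun k ↦ ‖Q‖ * (‖W‖ ^ 2) ^ k)
      ((summable_geometric_of_lt_one (by positivity) hlt).mul_left _) ?_
    filter_upwards [Filter.eventually_gt_atTop 0] with k hk
    calc ‖W ^ k * Q * star (W ^ k)‖ ≤ ‖W ^ k‖ * ‖Q‖ * ‖star (W ^ k)‖ := norm_mul₃_le
      _ ≤ ‖W‖ ^ k * ‖Q‖ * ‖W‖ ^ k := by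
          rw [norm_star]
          gcongr <;> exact norm_pow_le' W hk
      _ = _ := by ring
  have hshift (k : ℕ) : f (k + 1) = W * f k * star W := by
    simp only [f, pow_succ' W k, star_mul, mul_assoc]
  have hsum : ∑' k, f (k + 1) = W * (∑' k, f k) * star W := by
    simp_rw [hshift]
    rw [(hsummable.mul_left W).tsum_mul_right, hsummable.tsum_mul_left]
  refine ⟨∑' k, f (k + 1), tsum_nonneg fun k ↦ star_right_conjugate_nonneg hQ _, ?_⟩
  conv_lhs => rw [hsum, hsummable.tsum_eq_zero_add]
  simp [f]

section Stabilization

variable {H U : Type*} [NormedAddCommGroup H] [InnerProductSpace ℂ H] [CompleteSpace H]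
  [NormedAddCommGroup U] [InnerProductSpace ℂ U] [CompleteSpace U]

/-- A lower bound for the column `(S, B*)` gives it a left inverse. -/
theorem exists_bezout_of_norm_sq_le (S : H →L[ℂ] H) (B : U →L[ℂ] H) {C : ℝ} (hC : 0 < C)
    (h : ∀ x, ‖x‖ ^ 2 ≤ C * (‖S x‖ ^ 2 + ‖adjoint B x‖ ^ 2)) :
    ∃ X Y : H →L[ℂ] H, X * S + Y * (B ∘L adjoint B) = 1 := by
  have hunit : IsUnit (adjoint S * S + B ∘L adjoint B) := by
    refine isUnit_of_forall_le_norm_inner_map _ (c := C⁻¹.toNNReal)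
      (Real.toNNReal_pos.2 (inv_pos.2 hC)) fun x ↦ ?_
    have h1 : inner ℂ ((adjoint S * S + B ∘L adjoint B) x) x =
        ((‖S x‖ ^ 2 + ‖adjoint B x‖ ^ 2 : ℝ) : ℂ) := by
      rw [add_apply, inner_add_left, mul_apply_eq_comp, adjoint_inner_left, comp_apply,
        ← adjoint_inner_right B, inner_self_eq_norm_sq_to_K, inner_self_eq_norm_sq_to_K]
      simp
    rw [h1, Complex.norm_real, Real.norm_of_nonneg (by positivity),
      Real.coe_toNNReal _ (inv_pos.2 hC).le, ← div_eq_mul_inv, div_le_iff₀' hC]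
    exact h x
  obtain ⟨u, hu⟩ := hunit
  refine ⟨↑u⁻¹ * adjoint S, ↑u⁻¹, ?_⟩
  rw [mul_assoc, ← mul_add, ← hu, Units.inv_mul]

/-- A nonnegative solution of the Stein equation is coercive under the Hautus condition. -/
theorem exists_coercive_of_stein {B : U →L[ℂ] H} {W Λ : H →L[ℂ] H} (hΛ : 0 ≤ Λ)
    (hstein : Λ = W * (B ∘L adjoint B + Λ) * star W)
    (hbez : ∀ ν : ℂ, ∃ X Y : H →L[ℂ] H,
      X * (algebraMap ℂ _ ν - star W) + Y * (B ∘L adjoint B * star W) = 1) :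
    ∃ δ : ℝ, 0 < δ ∧ ∀ x, δ * ‖x‖ ^ 2 ≤ (inner ℂ (Λ x) x).re := by
  let V : H → ℝ := fun x ↦ (inner ℂ (Λ x) x).re
  have hV (x : H) : 0 ≤ V x := ((nonneg_iff_isPositive Λ).1 hΛ).re_inner_nonneg_left x
  have hVW (x : H) : V x = ‖adjoint B (star W x)‖ ^ 2 + V (star W x) := by
    have h1 : Λ x = W (B (adjoint B (star W x)) + Λ (star W x)) := by
      conv_lhs => rw [hstein]
      rfl
    have h2 : inner ℂ (Λ x) x = inner ℂ (adjoint B (star W x)) (adjoint B (star W x)) +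
        inner ℂ (Λ (star W x)) (star W x) := by
      rw [h1, ← adjoint_inner_right W, ← star_eq_adjoint, inner_add_left, adjoint_inner_right]
    simp only [V]
    rw [h2, Complex.add_re, inner_self_eq_norm_sq_to_K]
    norm_cast
  let L : Ideal (H →L[ℂ] H) :=
    { carrier := {T | ∃ c : ℝ, 0 ≤ c ∧ ∀ x, ‖T x‖ ^ 2 ≤ c * V x}
      add_mem' := by
        rintro S T ⟨c, hc, hS⟩ ⟨d, hd, hT⟩
        refine ⟨2 * c + 2 * d, by positivity, fun x ↦ ?_⟩
        have h1 := pow_le_pow_left₀ (norm_nonneg _) (norm_add_le (S x) (T x)) 2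
        rw [add_apply]
        nlinarith [hS x, hT x, sq_nonneg (‖S x‖ - ‖T x‖)]
      zero_mem' := ⟨0, le_rfl, fun x ↦ by simp⟩
      smul_mem' := by
        rintro S T ⟨c, hc, hT⟩
        refine ⟨‖S‖ ^ 2 * c, by positivity, fun x ↦ ?_⟩
        calc ‖S (T x)‖ ^ 2 ≤ (‖S‖ * ‖T x‖) ^ 2 := by gcongr; exact S.le_opNorm _
          _ = ‖S‖ ^ 2 * ‖T x‖ ^ 2 := by ring
          _ ≤ ‖S‖ ^ 2 * (c * V x) := by gcongr; exact hT x
          _ = _ := by ring }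
  have hLW : ∀ T ∈ L, T * star W ∈ L := by
    rintro T ⟨c, hc, hT⟩
    refine ⟨c, hc, fun x ↦ (hT (star W x)).trans ?_⟩
    rw [hVW x]
    gcongr
    exact le_add_of_nonneg_left (by positivity)
  have hLB : B ∘L adjoint B * star W ∈ L := by
    refine ⟨‖B‖ ^ 2, by positivity, fun x ↦ ?_⟩
    calc ‖B (adjoint B (star W x))‖ ^ 2 ≤ (‖B‖ * ‖adjoint B (star W x)‖) ^ 2 := by
          gcongr; exact B.le_opNorm _
      _ = ‖B‖ ^ 2 * ‖adjoint B (star W x)‖ ^ 2 := by ring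
      _ ≤ ‖B‖ ^ 2 * V x := by
          gcongr
          rw [hVW x]
          exact le_add_of_nonneg_right (hV _)
  obtain ⟨c, hc, h1⟩ : (1 : H →L[ℂ] H) ∈ L := by
    refine one_mem_of_leftIdeal L (star W) hLW fun ν ↦ ?_
    obtain ⟨X, Y, hXY⟩ := hbez ν
    refine ⟨X, ?_⟩
    rw [← hXY, sub_add_cancel_left]
    exact L.neg_mem (L.mul_mem_left Y hLB)
  refine ⟨(c + 1)⁻¹, by positivity, fun x ↦ ?_⟩
  rw [inv_mul_le_iff₀ (by positivity)]
  have := h1 x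
  rw [one_apply_eq_self] at this
  change _ ≤ (c + 1) * V x
  linarith [hV x]

theorem norm_exp_adjoint (S : H →L[ℂ] H) (t : ℝ) :
    ‖NormedSpace.exp (t • adjoint S)‖ = ‖NormedSpace.exp (t • S)‖ := by
  rw [← norm_star (NormedSpace.exp (t • S)), NormedSpace.star_exp, star_smul, star_eq_adjoint]
  simp

/-- The pointwise Hautus test for `(A*, B*)` yields feedbacks with arbitrary decay rate. -/
theorem exists_feedback_of_hautus (A : H →L[ℂ] H) (B : U →L[ℂ] H)
    (h : ∀ lam : ℂ, ∃ C : ℝ, 0 < C ∧ ∀ x,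
      ‖x‖ ^ 2 ≤ C * (‖lam • x - adjoint A x‖ ^ 2 + ‖adjoint B x‖ ^ 2))
    {α : ℝ} (hα : 0 < α) : ∃ K : H →L[ℂ] U, ∃ M : ℝ, 0 < M ∧
      ∀ t : ℝ, 0 ≤ t →
        ‖NormedSpace.exp (t • (A + B ∘L K))‖ ≤ M * Real.exp (-α * t) := by
  set ω : ℝ := ‖A‖ + 1 + α with hω
  let P : H →L[ℂ] H := A + algebraMap ℂ _ ((ω + 1 : ℝ) : ℂ)
  have hP_apply (x : H) : P x = A x + ((ω + 1 : ℝ) : ℂ) • x := by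
    simp [P, Algebra.algebraMap_eq_smul_one]
  have hPadj_apply (x : H) : star P x = adjoint A x + ((ω + 1 : ℝ) : ℂ) • x := by
    have : star P = adjoint A + ((ω + 1 : ℝ) : ℂ) • (1 : H →L[ℂ] H) := by
      simp only [P, Algebra.algebraMap_eq_smul_one, star_add, star_smul, star_one,
        star_eq_adjoint A, RCLike.star_def, Complex.conj_ofReal]
    rw [this]; simp
  have hlow (x : H) : 2 * ‖x‖ ≤ ‖P x‖ := by
    have h1 : ‖((ω + 1 : ℝ) : ℂ) • x‖ ≤ ‖P x‖ + ‖A x‖ := by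
      refine le_trans (le_of_eq ?_) (norm_sub_le _ _)
      rw [hP_apply]; congr 1; abel
    rw [norm_smul, Complex.norm_real, Real.norm_of_nonneg (by positivity)] at h1
    have h2 := A.le_opNorm x
    nlinarith [norm_nonneg x]
  obtain ⟨u, hu⟩ : IsUnit P := by
    have h1 : -((ω + 1 : ℝ) : ℂ) ∈ resolventSet ℂ A := by
      refine spectrum.mem_resolventSet_of_norm_lt_mul ?_
      rw [norm_neg, Complex.norm_real, Real.norm_of_nonneg (by positivity)]
      have h2 : ‖A‖ * ‖(1 : H →L[ℂ] H)‖ ≤ ‖A‖ * 1 := by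
        gcongr; exact norm_id_le
      linarith
    have h2 : IsUnit (-(algebraMap ℂ (H →L[ℂ] H) (-((ω + 1 : ℝ) : ℂ)) - A)) := IsUnit.neg h1
    refine (congrArg IsUnit ?_).mp h2
    simp only [P, map_neg]; abel
  let W : H →L[ℂ] H := ↑u⁻¹
  have hPW : P * W = 1 := by rw [← hu]; exact u.mul_inv
  have hWP : W * P = 1 := by rw [← hu]; exact u.inv_mul
  have hPWs : star P * star W = 1 := by rw [← star_mul, hWP, star_one]
  have hWPs : star W * star P = 1 := by rw [← star_mul, hPW, star_one]
  have hW : ‖W‖ < 1 := by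
    refine (opNorm_le_bound W (M := 1 / 2) (by norm_num) fun x ↦ ?_).trans_lt (by norm_num)
    have h1 := hlow (W x)
    rw [← mul_apply_eq_comp, hPW, one_apply_eq_self] at h1
    linarith
  have hQ : 0 ≤ B ∘L adjoint B := by
    rw [nonneg_iff_isPositive]
    exact isPositive_self_comp_adjoint B
  obtain ⟨Λ, hΛ, hstein⟩ := exists_nonneg_stein hW hQ
  have hΛpos := (nonneg_iff_isPositive Λ).1 hΛ
  obtain ⟨δ, hδ, hcoer⟩ := exists_coercive_of_stein hΛ hstein fun ν ↦ by
    rcases eq_or_ne ν 0 with rfl | hν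
    · exact ⟨-star P, 0, by simp [hPWs]⟩
    · obtain ⟨C, hC, hb⟩ := h (ν⁻¹ - ((ω + 1 : ℝ) : ℂ))
      obtain ⟨X, Y, hXY⟩ := exists_bezout_of_norm_sq_le
        ((ν⁻¹ - ((ω + 1 : ℝ) : ℂ)) • (1 : H →L[ℂ] H) - adjoint A) B hC
        fun x ↦ by simpa using hb x
      refine ⟨-ν⁻¹ • (star P * X), star P * Y, ?_⟩
      have hkey : algebraMap ℂ _ ν - star W =
          (-ν) • (((ν⁻¹ - ((ω + 1 : ℝ) : ℂ)) • (1 : H →L[ℂ] H) - adjoint A) * star W) := by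
        have h1 : (ν⁻¹ - ((ω + 1 : ℝ) : ℂ)) • (1 : H →L[ℂ] H) - adjoint A =
            ν⁻¹ • (1 : H →L[ℂ] H) - star P := by
          ext x
          rw [sub_apply, sub_apply, hPadj_apply, smul_apply, smul_apply, one_apply_eq_self,
            sub_smul]
          abel
        rw [h1, sub_mul, hPWs, smul_mul_assoc, one_mul, smul_sub, smul_smul,
          Algebra.algebraMap_eq_smul_one, neg_mul, mul_inv_cancel₀ hν]
        simp only [neg_smul, one_smul]
        abel
      have h3 : star P * (X * ((ν⁻¹ - ((ω + 1 : ℝ) : ℂ)) • (1 : H →L[ℂ] H) - adjoint A) +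
          Y * (B ∘L adjoint B)) * star W = 1 := by rw [hXY, mul_one, hPWs]
      rw [hkey, smul_mul_smul_comm, neg_mul_neg, inv_mul_cancel₀ hν, one_smul]
      refine Eq.trans ?_ h3
      simp only [mul_add, add_mul, mul_assoc]
  obtain ⟨v, hv⟩ : IsUnit Λ := by
    refine isUnit_of_forall_le_norm_inner_map _ (c := δ.toNNReal)
      (Real.toNNReal_pos.2 hδ) fun x ↦ ?_
    rw [Real.coe_toNNReal _ hδ.le, mul_comm]
    exact (hcoer x).trans (Complex.re_le_norm _)
  have hvΛ (x : H) : ((v⁻¹ : (H →L[ℂ] H)ˣ) : H →L[ℂ] H) (Λ x) = x := by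
    rw [← hv, ← mul_apply_eq_comp, Units.inv_mul, one_apply_eq_self]
  let K : H →L[ℂ] U := -(adjoint B ∘L ((v⁻¹ : (H →L[ℂ] H)ˣ) : H →L[ℂ] H))
  have hlyap (x : H) : (inner ℂ (Λ x) (adjoint (A + B ∘L K) x)).re ≤
      -α * (inner ℂ (Λ x) x).re := by
    have h1 : inner ℂ (Λ x) (adjoint (A + B ∘L K) x) =
        inner ℂ (Λ x) (adjoint A x) - inner ℂ (adjoint B x) (adjoint B x) := by
      rw [adjoint_inner_right, adjoint_inner_right, adjoint_inner_right, ← inner_sub_left]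
      congr 1
      simp [K, hvΛ, sub_eq_add_neg]
    have h2 : inner ℂ (Λ (star P x)) (star P x) =
        inner ℂ (adjoint B x) (adjoint B x) + inner ℂ (Λ x) x := by
      have h3 : P * Λ * star P = B ∘L adjoint B + Λ := by
        conv_lhs => rw [hstein]
        rw [← mul_assoc, ← mul_assoc, hPW, one_mul, mul_assoc, hWPs, mul_one]
      rw [star_eq_adjoint, adjoint_inner_right, ← star_eq_adjoint]
      change inner ℂ ((P * Λ * star P) x) x = _
      rw [h3, add_apply, inner_add_left, comp_apply, adjoint_inner_right]
    obtain ⟨d, hd⟩ : ∃ d, d = adjoint A x + (ω : ℂ) • x := ⟨_, rfl⟩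
    have hPd : star P x = d + x := by
      rw [hPadj_apply, hd]; push_cast; rw [add_smul, one_smul, add_assoc]
    have h4 : (inner ℂ (Λ d) x).re = (inner ℂ (Λ x) d).re := by
      have h3 : inner ℂ (Λ d) x = inner ℂ d (Λ x) := hΛpos.isSelfAdjoint.isSymmetric d x
      rw [h3]
      exact inner_re_symm (𝕜 := ℂ) d (Λ x)
    have h5 : (inner ℂ (Λ x) d).re =
        (inner ℂ (Λ x) (adjoint A x)).re + ω * (inner ℂ (Λ x) x).re := by
      rw [hd, inner_add_right, inner_smul_right, Complex.add_re, Complex.re_ofReal_mul]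
    have h6 := congrArg Complex.re h2
    rw [hPd, map_add, inner_add_left, inner_add_right, inner_add_right] at h6
    simp only [Complex.add_re] at h6
    have h7 : 0 ≤ (inner ℂ (Λ d) d).re := hΛpos.re_inner_nonneg_left d
    have h8 : 0 ≤ (inner ℂ (Λ x) x).re := hΛpos.re_inner_nonneg_left x
    have h9 : 0 ≤ (inner ℂ (adjoint B x) (adjoint B x)).re :=
      inner_self_nonneg (𝕜 := ℂ)
    have h10 : α * (inner ℂ (Λ x) x).re ≤ ω * (inner ℂ (Λ x) x).re := by
      gcongr; rw [hω]; linarith [norm_nonneg A]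
    rw [h1, Complex.sub_re]
    linarith
  refine ⟨K, √(‖Λ‖ / δ) + 1, by positivity, fun t ht ↦ ?_⟩
  rw [← norm_exp_adjoint]
  refine (norm_exp_le_of_lyapunov _ Λ hΛpos.isSelfAdjoint hδ hcoer hlyap ht).trans ?_
  gcongr
  linarith

end Stabilization

/-- For `A` a bounded normal operator on a separable complex Hilbert space `H` and
`B : U →L H` bounded, the system `[A,B]` is rapidly stabilizable iff the pair
`(A*, B*)` satisfies the quantitative frequency-domain condition (HESI)_β for every `β > 0`. -/
theorem rapidly_stabilizable_iff_HESI_of_normal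
    {H U : Type*}
    [NormedAddCommGroup H] [InnerProductSpace ℂ H] [CompleteSpace H]
    [TopologicalSpace.SeparableSpace H]
    [NormedAddCommGroup U] [InnerProductSpace ℂ U] [CompleteSpace U]
    [TopologicalSpace.SeparableSpace U]
    (A : H →L[ℂ] H) (B : U →L[ℂ] H)
    (hA : A ∘L ContinuousLinearMap.adjoint A = ContinuousLinearMap.adjoint A ∘L A) :
    (∀ α : ℝ, 0 < α → ∃ K : H →L[ℂ] U, ∃ M : ℝ, 0 < M ∧
      ∀ t : ℝ, 0 ≤ t →
        ‖NormedSpace.exp (t • (A + B ∘L K))‖ ≤ M * Real.exp (-α * t)) ↔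
    (∀ β : ℝ, 0 < β → ∃ C : ℝ, 0 < C ∧ ∀ lam : ℂ, -β < lam.re → ∀ φ : H,
      ‖φ‖ ^ 2 ≤ C / (lam.re + β) ^ 2 *
        (‖lam • φ - (ContinuousLinearMap.adjoint A) φ‖ ^ 2
          + ‖(ContinuousLinearMap.adjoint B) φ‖ ^ 2)) := by
  constructor
  · intro h β hβ
    obtain ⟨K, M, hM, hK⟩ := h β hβ
    refine ⟨2 * M ^ 2 * (1 + ‖adjoint K‖ ^ 2), by positivity, fun lam hlam φ ↦ ?_⟩
    have hr : 0 < lam.re + β := by linarith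
    have h1 := norm_sub_ge_of_norm_exp_le (adjoint (A + B ∘L K))
      (fun t ht ↦ (norm_exp_adjoint _ t).trans_le (hK t ht)) hlam φ
    have h2 : lam • φ - adjoint (A + B ∘L K) φ =
        (lam • φ - adjoint A φ) - adjoint K (adjoint B φ) := by
      rw [map_add, adjoint_comp, add_apply, comp_apply, sub_sub]
    have h3 : ‖lam • φ - adjoint (A + B ∘L K) φ‖ ≤
        ‖lam • φ - adjoint A φ‖ + ‖adjoint K‖ * ‖adjoint B φ‖ := by
      rw [h2]
      exact (norm_sub_le _ _).trans (by gcongr; exact le_opNorm _ _)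
    have h4 : ((lam.re + β) * ‖φ‖) ^ 2 ≤
        (M * (‖lam • φ - adjoint A φ‖ + ‖adjoint K‖ * ‖adjoint B φ‖)) ^ 2 :=
      pow_le_pow_left₀ (by positivity) (h1.trans (by gcongr)) 2
    rw [div_mul_eq_mul_div, le_div_iff₀ (by positivity)]
    have h5 : (‖lam • φ - adjoint A φ‖ + ‖adjoint K‖ * ‖adjoint B φ‖) ^ 2 ≤
        2 * (1 + ‖adjoint K‖ ^ 2) * (‖lam • φ - adjoint A φ‖ ^ 2 + ‖adjoint B φ‖ ^ 2) := by
      nlinarith [sq_nonneg (‖lam • φ - adjoint A φ‖ - ‖adjoint K‖ * ‖adjoint B φ‖),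
        mul_nonneg (sq_nonneg ‖adjoint K‖) (sq_nonneg ‖lam • φ - adjoint A φ‖),
        sq_nonneg ‖adjoint B φ‖]
    have h6 := mul_le_mul_of_nonneg_left h5 (sq_nonneg M)
    rw [mul_pow, mul_pow] at h4
    linarith
  · intro h α hα
    refine exists_feedback_of_hautus A B (fun lam ↦ ?_) hα
    obtain ⟨C, hC, hb⟩ := h (|lam.re| + 1) (by positivity)
    have hlam : -(|lam.re| + 1) < lam.re := by linarith [neg_abs_le lam.re]
    have hpos : 0 < lam.re + (|lam.re| + 1) := by linarith
    exact ⟨C / (lam.re + (|lam.re| + 1)) ^ 2, by positivity, hb lam hlam⟩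
end
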